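/- For every odd integer ℓ ≥ 1 there is a constant c' > 0 depending only on ℓ such that for every n ≥ 3 the following holds: if a = (a_1,…,a_n) is a uniform random point of the unit sphere S^{n-1} ⊆ ℝ^n, independent of X, and p(x) = Σ_{i=1}^n a_i p_ℓ^{(i)}(x), then 𝔼_a[ d_TV(p(X), Z) ] ≤ c'/√n, where the total variation distance is computed for fixed a (conditionally on a) and then averaged over a. -/

import Mathlib

open MeasureTheory ProbabilityTheory Real Finset

noncomputable section

/-- total variation distance between two (Borel) measures on ℝ -/
def dTV (μ ν : MeasureTheory.Measure ℝ) : ℝ :=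
  ⨆ s : {s : Set ℝ // MeasurableSet s}, |(μ s.1).toReal - (ν s.1).toReal|

/-- uniform probability measure on the unit sphere of a Euclidean space -/
def sphereUniform (ι : Type*) [Fintype ι] :
    MeasureTheory.Measure (Metric.sphere (0 : EuclideanSpace ℝ ι) 1) :=
  ((volume : MeasureTheory.Measure (EuclideanSpace ℝ ι)).toSphere Set.univ)⁻¹ •
    (volume : MeasureTheory.Measure (EuclideanSpace ℝ ι)).toSphere

/-- The Gegenbauer polynomial `C^k_m(t)`. -/
def gegenbauer (k : ℝ) (m : ℕ) (t : ℝ) : ℝ :=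
  (2 ^ m / Real.Gamma k) * ∑ j ∈ Finset.range (m / 2 + 1),
    ((-1 : ℝ) ^ j * Real.Gamma (k + m - j) * t ^ (m - 2 * j)) /
      (2 ^ (2 * j) * (Nat.factorial j) * (Nat.factorial (m - 2 * j)))

/-- The normalizing constant `A_{n,ℓ}`, with `A² = (n−3)!ℓ!(n+2ℓ−2)/((n+ℓ−3)!(n−2))`. -/
def Aconst (n ℓ : ℕ) : ℝ :=
  Real.sqrt (((Nat.factorial (n - 3) : ℝ) * Nat.factorial ℓ * (n + 2 * ℓ - 2)) /
    ((Nat.factorial (n + ℓ - 3) : ℝ) * (n - 2)))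

/-- The eigenfunction `p_ℓ^{(i)}(x) = A_{n,ℓ} C^{(n-2)/2}_ℓ(x_i)`. -/
def pli (n ℓ : ℕ) (i : Fin n) (x : EuclideanSpace ℝ (Fin n)) : ℝ :=
  Aconst n ℓ * gegenbauer (((n : ℝ) - 2) / 2) ℓ (x i)

/-- The mean of a function over the uniform measure on the unit sphere. -/
def sphereMean {n : ℕ} (F : EuclideanSpace ℝ (Fin n) → ℝ) : ℝ :=
  ∫ x : Metric.sphere (0 : EuclideanSpace ℝ (Fin n)) 1, F x ∂(sphereUniform (Fin n))

lemma isProbabilityMeasure_sphereUniform {n : ℕ} (hn : 1 ≤ n) :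
    IsProbabilityMeasure (sphereUniform (Fin n)) := by
  have : Nonempty (Fin n) := ⟨⟨0, hn⟩⟩
  constructor
  rw [sphereUniform, Measure.smul_apply, smul_eq_mul]
  apply ENNReal.inv_mul_cancel
  · exact Measure.measure_univ_ne_zero.2 (Measure.toSphere_ne_zero _)
  · exact measure_ne_top _ _

lemma Continuous.integrable_sphereUniform {n : ℕ} [IsProbabilityMeasure (sphereUniform (Fin n))]
    {F : EuclideanSpace ℝ (Fin n) → ℝ} (hF : Continuous F) :
    Integrable (fun x : Metric.sphere (0 : EuclideanSpace ℝ (Fin n)) 1 => F x)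
      (sphereUniform (Fin n)) :=
  (hF.comp continuous_subtype_val).integrable_of_hasCompactSupport
    (HasCompactSupport.of_compactSpace _)

/-- The action of a linear isometry on the unit sphere. -/
def sphereMap {n : ℕ} (L : EuclideanSpace ℝ (Fin n) →ₗᵢ[ℝ] EuclideanSpace ℝ (Fin n))
    (x : Metric.sphere (0 : EuclideanSpace ℝ (Fin n)) 1) :
    Metric.sphere (0 : EuclideanSpace ℝ (Fin n)) 1 :=
  ⟨L x, by simp⟩

open scoped Pointwise in
lemma measurePreserving_sphereMap {n : ℕ}
    (L : EuclideanSpace ℝ (Fin n) →ₗᵢ[ℝ] EuclideanSpace ℝ (Fin n)) :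
    MeasurePreserving (sphereMap L) (sphereUniform (Fin n)) (sphereUniform (Fin n)) := by
  have hc : Continuous (sphereMap L) := by
    unfold sphereMap
    fun_prop
  refine ⟨hc.measurable, ?_⟩
  let L' := L.toLinearIsometryEquiv rfl
  have hL' : ∀ x, L' x = L x := fun x => rfl
  ext s hs
  rw [Measure.map_apply hc.measurable hs, sphereUniform, Measure.smul_apply, Measure.smul_apply,
    Measure.toSphere_apply' _ hs, Measure.toSphere_apply' _ (hc.measurable hs)]
  congr 2
  rw [← (show MeasurePreserving L'.toMeasurableEquiv volume volume from
    L'.measurePreserving).measure_preimage_equiv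
    (Set.Ioo (0 : ℝ) 1 • (Subtype.val '' s))]
  congr 1
  ext x
  simp only [Set.mem_smul, Set.mem_preimage, Set.mem_image]
  constructor
  · rintro ⟨r, hr, _, ⟨y, hy, rfl⟩, rfl⟩
    exact ⟨r, hr, _, ⟨_, hy, rfl⟩,
      (map_smul L r (y : EuclideanSpace ℝ (Fin n))).symm⟩
  · rintro ⟨r, hr, _, ⟨y, hy, rfl⟩, h⟩
    have hy1 : ‖L'.symm (y : EuclideanSpace ℝ (Fin n))‖ = 1 := by simp
    refine ⟨r, hr, _, ⟨⟨L'.symm y, by simp⟩, ?_, rfl⟩, ?_⟩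
    · have : sphereMap L ⟨L'.symm y, by simp⟩ = y := by
        ext1
        simp only [sphereMap, ← hL', LinearIsometryEquiv.apply_symm_apply]
      rw [this]
      exact hy
    · apply L'.injective
      rw [map_smul, LinearIsometryEquiv.apply_symm_apply]
      exact h

lemma sphereMean_comp {n : ℕ} (L : EuclideanSpace ℝ (Fin n) →ₗᵢ[ℝ] EuclideanSpace ℝ (Fin n))
    {F : EuclideanSpace ℝ (Fin n) → ℝ} (hF : Continuous F) :
    sphereMean (fun x => F (L x)) = sphereMean F := by
  have h := measurePreserving_sphereMap L
  unfold sphereMean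
  conv_rhs => rw [← h.map_eq]
  exact (integral_map h.measurable.aemeasurable
    (hF.comp continuous_subtype_val).aestronglyMeasurable).symm

/-- Rotation by the angle `θ` in the plane spanned by the orthonormal vectors `e`, `f`. -/
def planeRotation {n : ℕ} (e f : EuclideanSpace ℝ (Fin n)) (he : ‖e‖ = 1) (hf : ‖f‖ = 1)
    (hef : inner ℝ e f = 0) (θ : ℝ) :
    EuclideanSpace ℝ (Fin n) →ₗᵢ[ℝ] EuclideanSpace ℝ (Fin n) where
  toFun x := x + ((cos θ - 1) * inner ℝ e x - sin θ * inner ℝ f x) • e +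
    (sin θ * inner ℝ e x + (cos θ - 1) * inner ℝ f x) • f
  map_add' x y := by
    simp only [inner_add_right]
    module
  map_smul' r x := by
    simp only [inner_smul_right, RingHom.id_apply]
    module
  norm_map' x := by
    have hfe : inner ℝ f e = 0 := by rw [real_inner_comm, hef]
    rw [← sq_eq_sq₀ (norm_nonneg _) (norm_nonneg _), ← real_inner_self_eq_norm_sq,
      ← real_inner_self_eq_norm_sq]
    simp only [LinearMap.coe_mk, AddHom.coe_mk, inner_add_right, inner_add_left, inner_smul_left,
      inner_smul_right, hef, hfe, real_inner_self_eq_norm_sq, he, hf, RCLike.conj_to_real]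
    rw [real_inner_comm e x, real_inner_comm f x]
    linear_combination ((inner ℝ e x) ^ 2 + (inner ℝ f x) ^ 2) * sin_sq_add_cos_sq θ

lemma planeRotation_apply {n : ℕ} {e f : EuclideanSpace ℝ (Fin n)} (he : ‖e‖ = 1) (hf : ‖f‖ = 1)
    (hef : inner ℝ e f = 0) (θ : ℝ) (x : EuclideanSpace ℝ (Fin n)) :
    planeRotation e f he hf hef θ x = x + ((cos θ - 1) * inner ℝ e x - sin θ * inner ℝ f x) • e +
      (sin θ * inner ℝ e x + (cos θ - 1) * inner ℝ f x) • f := rfl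

lemma planeRotation_zero {n : ℕ} {e f : EuclideanSpace ℝ (Fin n)} (he : ‖e‖ = 1) (hf : ‖f‖ = 1)
    (hef : inner ℝ e f = 0) (x : EuclideanSpace ℝ (Fin n)) :
    planeRotation e f he hf hef 0 x = x := by
  simp [planeRotation_apply]

lemma hasDerivAt_planeRotation {n : ℕ} {e f : EuclideanSpace ℝ (Fin n)} (he : ‖e‖ = 1)
    (hf : ‖f‖ = 1) (hef : inner ℝ e f = 0) (x : EuclideanSpace ℝ (Fin n)) (θ : ℝ) :
    HasDerivAt (fun t => planeRotation e f he hf hef t x)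
      (inner ℝ e (planeRotation e f he hf hef θ x) • f -
        inner ℝ f (planeRotation e f he hf hef θ x) • e) θ := by
  have hfe : inner ℝ f e = 0 := by rw [real_inner_comm, hef]
  have h1 := ((((hasDerivAt_cos θ).sub_const 1).mul_const (inner ℝ e x)).sub
    ((hasDerivAt_sin θ).mul_const (inner ℝ f x))).smul_const e
  have h2 := (((hasDerivAt_sin θ).mul_const (inner ℝ e x)).add
    (((hasDerivAt_cos θ).sub_const 1).mul_const (inner ℝ f x))).smul_const f
  refine ((h1.const_add x).add h2).congr_deriv ?_
  simp only [planeRotation_apply,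
    inner_add_right, inner_smul_right, hef, hfe, real_inner_self_eq_norm_sq, he, hf]
  module

lemma sphereMean_rotation_derivative {n : ℕ} (hn : 1 ≤ n) {e f : EuclideanSpace ℝ (Fin n)}
    (he : ‖e‖ = 1) (hf : ‖f‖ = 1) (hef : inner ℝ e f = 0)
    {u : EuclideanSpace ℝ (Fin n) → ℝ}
    {u' : EuclideanSpace ℝ (Fin n) → EuclideanSpace ℝ (Fin n) →L[ℝ] ℝ}
    (hu : ∀ x, HasFDerivAt u (u' x) x) (hu' : Continuous u') :
    sphereMean (fun x => u' x (inner ℝ e x • f - inner ℝ f x • e)) = 0 := by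
  have := isProbabilityMeasure_sphereUniform hn
  have huc : Continuous u := continuous_iff_continuousAt.2 fun x => (hu x).continuousAt
  set v : EuclideanSpace ℝ (Fin n) → ℝ := fun x => u' x (inner ℝ e x • f - inner ℝ f x • e)
    with hv
  have hvc : Continuous v := by
    rw [hv]
    exact hu'.clm_apply (by fun_prop)
  obtain ⟨C, hC⟩ := (isCompact_sphere (0 : EuclideanSpace ℝ (Fin n)) 1).exists_bound_of_continuousOn
    hvc.continuousOn
  set R := planeRotation e f he hf hef
  have hd : ∀ x θ, HasDerivAt (fun t => u (R t x)) (v (R θ x)) θ := fun x θ =>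
    (hu (R θ x)).comp_hasDerivAt θ (hasDerivAt_planeRotation he hf hef x θ)
  have key := hasDerivAt_integral_of_dominated_loc_of_deriv_le
    (μ := sphereUniform (Fin n)) (s := Set.univ) (x₀ := (0 : ℝ)) (bound := fun _ => C)
    (F := fun θ (x : Metric.sphere (0 : EuclideanSpace ℝ (Fin n)) 1) => u (R θ x))
    (F' := fun θ x => v (R θ x)) Filter.univ_mem
    (Filter.Eventually.of_forall fun θ =>
      (huc.comp (R θ).continuous).integrable_sphereUniform.aestronglyMeasurable)
    (huc.comp (R 0).continuous).integrable_sphereUniform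
    (hvc.comp (R 0).continuous).integrable_sphereUniform.aestronglyMeasurable
    (Filter.Eventually.of_forall fun x θ _ => hC _ (by simp))
    (integrable_const _)
    (Filter.Eventually.of_forall fun x θ _ => hd x θ)
  have h1 : (fun θ => ∫ x : Metric.sphere (0 : EuclideanSpace ℝ (Fin n)) 1, u (R θ x)
      ∂(sphereUniform (Fin n))) = fun _ => sphereMean u := by
    ext θ
    exact sphereMean_comp (R θ) huc
  have h2 := key.2
  rw [h1] at h2
  have h3 := h2.unique (hasDerivAt_const _ _)
  simpa [sphereMean, R, planeRotation_zero] using h3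

lemma sphereMean_congr {n : ℕ} {F G : EuclideanSpace ℝ (Fin n) → ℝ}
    (h : ∀ x, ‖x‖ = 1 → F x = G x) : sphereMean F = sphereMean G :=
  integral_congr_ae (Filter.Eventually.of_forall fun x => h x (by simp))

lemma sphereMean_const_mul {n : ℕ} (r : ℝ) (F : EuclideanSpace ℝ (Fin n) → ℝ) :
    sphereMean (fun x => r * F x) = r * sphereMean F :=
  integral_const_mul _ _

lemma sphereMean_const {n : ℕ} (hn : 1 ≤ n) (r : ℝ) :
    sphereMean (fun _ : EuclideanSpace ℝ (Fin n) => r) = r := by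
  have := isProbabilityMeasure_sphereUniform hn
  simp [sphereMean]

lemma sphereMean_add {n : ℕ} (hn : 1 ≤ n) {F G : EuclideanSpace ℝ (Fin n) → ℝ}
    (hF : Continuous F) (hG : Continuous G) :
    sphereMean (fun x => F x + G x) = sphereMean F + sphereMean G := by
  have := isProbabilityMeasure_sphereUniform hn
  exact integral_add hF.integrable_sphereUniform hG.integrable_sphereUniform

lemma sphereMean_sub {n : ℕ} (hn : 1 ≤ n) {F G : EuclideanSpace ℝ (Fin n) → ℝ}
    (hF : Continuous F) (hG : Continuous G) :
    sphereMean (fun x => F x - G x) = sphereMean F - sphereMean G := by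
  have := isProbabilityMeasure_sphereUniform hn
  exact integral_sub hF.integrable_sphereUniform hG.integrable_sphereUniform

lemma sphereMean_sum {n : ℕ} (hn : 1 ≤ n) {ι : Type*} (s : Finset ι)
    {F : ι → EuclideanSpace ℝ (Fin n) → ℝ} (hF : ∀ i ∈ s, Continuous (F i)) :
    sphereMean (fun x => ∑ i ∈ s, F i x) = ∑ i ∈ s, sphereMean (F i) := by
  have := isProbabilityMeasure_sphereUniform hn
  exact integral_finsetSum s fun i hi => (hF i hi).integrable_sphereUniform

lemma sphereMean_mono {n : ℕ} (hn : 1 ≤ n) {F G : EuclideanSpace ℝ (Fin n) → ℝ}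
    (hF : Continuous F) (hG : Continuous G) (h : ∀ x, ‖x‖ = 1 → F x ≤ G x) :
    sphereMean F ≤ sphereMean G := by
  have := isProbabilityMeasure_sphereUniform hn
  exact integral_mono hF.integrable_sphereUniform hG.integrable_sphereUniform
    fun x => h x (by simp)

lemma sum_sq_eq_one {n : ℕ} {x : EuclideanSpace ℝ (Fin n)} (hx : ‖x‖ = 1) :
    ∑ i, x i ^ 2 = 1 := by
  rw [← EuclideanSpace.real_norm_sq_eq, hx, one_pow]

lemma continuous_coord {n : ℕ} (i : Fin n) :
    Continuous (fun x : EuclideanSpace ℝ (Fin n) => x i) :=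
  (EuclideanSpace.proj (𝕜 := ℝ) i).continuous

lemma inner_single_eq_coord {n : ℕ} (j : Fin n) (x : EuclideanSpace ℝ (Fin n)) :
    inner ℝ (EuclideanSpace.single j (1 : ℝ)) x = x j := by
  rw [EuclideanSpace.inner_single_left]
  simp

/-- Integration by parts on the sphere. -/
lemma sphereMean_integration_by_parts {n : ℕ} (hn : 1 ≤ n) {u : EuclideanSpace ℝ (Fin n) → ℝ}
    {u' : EuclideanSpace ℝ (Fin n) → EuclideanSpace ℝ (Fin n) →L[ℝ] ℝ}
    (hu : ∀ x, HasFDerivAt u (u' x) x) (hu' : Continuous u') (i : Fin n) :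
    sphereMean (fun x => u' x (EuclideanSpace.single i 1)) =
      sphereMean (fun x => ((n : ℝ) - 1) * x i * u x + x i * u' x x) := by
  have huc : Continuous u := continuous_iff_continuousAt.2 fun x => (hu x).continuousAt
  have hpc := fun j : Fin n => continuous_coord j
  set w : Fin n → EuclideanSpace ℝ (Fin n) → EuclideanSpace ℝ (Fin n) →L[ℝ] ℝ :=
    fun j x => x j • u' x + u x • EuclideanSpace.proj j with hw
  have hwd : ∀ j x, HasFDerivAt (fun y : EuclideanSpace ℝ (Fin n) => y j * u y) (w j x) x :=
    fun j x => (EuclideanSpace.proj (𝕜 := ℝ) j).hasFDerivAt.mul (hu x)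
  have hwc : ∀ j, Continuous (w j) := fun j =>
    ((hpc j).smul hu').add (huc.smul continuous_const)
  have hv : ∀ j, Continuous fun x : EuclideanSpace ℝ (Fin n) =>
      w j x (x j • EuclideanSpace.single i 1 - x i • EuclideanSpace.single j 1) := fun j =>
    (hwc j).clm_apply (((hpc j).smul continuous_const).sub ((hpc i).smul continuous_const))
  have h0 : ∀ j, sphereMean (fun x : EuclideanSpace ℝ (Fin n) =>
      w j x (x j • EuclideanSpace.single i 1 - x i • EuclideanSpace.single j 1)) = 0 := by
    intro j
    by_cases hij : j = i
    · subst hij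
      simp [sphereMean]
    · have := sphereMean_rotation_derivative hn (e := EuclideanSpace.single j (1 : ℝ))
        (f := EuclideanSpace.single i (1 : ℝ)) (by simp) (by simp)
        (by simp [inner_single_eq_coord, hij])
        (hwd j) (hwc j)
      simpa only [inner_single_eq_coord] using this
  have hsum := sphereMean_sum hn Finset.univ fun j _ => hv j
  rw [Finset.sum_eq_zero fun j _ => h0 j] at hsum
  rw [← sub_eq_zero, ← sphereMean_sub hn (hu'.clm_apply continuous_const) (by fun_prop), ← hsum]
  refine sphereMean_congr fun x hx => ?_
  have hxs : u' x x = ∑ j, x j * u' x (EuclideanSpace.single j 1) := by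
    have h := congrArg (u' x) ((EuclideanSpace.basisFun (Fin n) ℝ).sum_repr x)
    rw [map_sum] at h
    rw [← h]
    simp
  have hterm : ∀ j, w j x (x j • EuclideanSpace.single i 1 - x i • EuclideanSpace.single j 1) =
      x j ^ 2 * u' x (EuclideanSpace.single i 1) - x i * (x j * u' x (EuclideanSpace.single j 1))
      + (if j = i then x j * u x else 0) - x i * u x := by
    intro j
    by_cases hji : j = i
    · simp [hw, hji]
      ring
    · simp [hw, hji]
      ring
  simp only [hterm, Finset.sum_add_distrib, Finset.sum_sub_distrib, ← Finset.sum_mul,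
    ← Finset.mul_sum, ← hxs, sum_sq_eq_one hx]
  simp
  ring

lemma hasFDerivAt_comp_coord {n : ℕ} {f f' : ℝ → ℝ} (hf : ∀ t, HasDerivAt f (f' t) t) (i : Fin n)
    (x : EuclideanSpace ℝ (Fin n)) :
    HasFDerivAt (fun y : EuclideanSpace ℝ (Fin n) => f (y i))
      (f' (x i) • EuclideanSpace.proj (𝕜 := ℝ) i) x :=
  (hf (x i)).comp_hasFDerivAt x (EuclideanSpace.proj (𝕜 := ℝ) i).hasFDerivAt

lemma continuous_eval_coord {n : ℕ} (q : Polynomial ℝ) (i : Fin n) :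
    Continuous (fun x : EuclideanSpace ℝ (Fin n) => q.eval (x i)) :=
  q.continuous.comp (continuous_coord i)

lemma sphereMean_coord_integration_by_parts {n : ℕ} (hn : 1 ≤ n) (q : Polynomial ℝ) (i : Fin n) :
    sphereMean (fun x : EuclideanSpace ℝ (Fin n) =>
        (1 - x i ^ 2) * q.derivative.eval (x i)) =
      ((n : ℝ) - 1) * sphereMean (fun x : EuclideanSpace ℝ (Fin n) => x i * q.eval (x i)) := by
  have hc := continuous_coord i
  have hq := continuous_eval_coord q i
  have hq' := continuous_eval_coord (Polynomial.derivative q) i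
  have h := sphereMean_integration_by_parts hn
    (fun x => hasFDerivAt_comp_coord (fun t => q.hasDerivAt t) i x)
    (by exact hq'.smul continuous_const) i
  rw [← sphereMean_const_mul, ← sub_eq_zero, ← sphereMean_sub hn (by fun_prop) (by fun_prop)]
  rw [← sub_eq_zero, ← sphereMean_sub hn] at h
  · rw [← h]
    refine sphereMean_congr fun x _ => ?_
    simp
    ring
  · simpa using hq'
  · simp
    fun_prop

/-- Recursion for mixed moments of two coordinates on the sphere. -/
lemma sphereMean_pow_mul_pow {n : ℕ} (hn : 1 ≤ n) {i j : Fin n} (hij : i ≠ j) (a b : ℕ) :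
    ((n : ℝ) + a + b) *
        sphereMean (fun x : EuclideanSpace ℝ (Fin n) => x i ^ (a + 2) * x j ^ b) =
      (a + 1) * sphereMean (fun x : EuclideanSpace ℝ (Fin n) => x i ^ a * x j ^ b) := by
  have hi := continuous_coord i
  have hj := continuous_coord j
  have h := sphereMean_integration_by_parts hn
    (fun x => (hasFDerivAt_comp_coord (fun t => hasDerivAt_pow (a + 1) t) i x).mul
      (hasFDerivAt_comp_coord (fun t => hasDerivAt_pow b t) j x))
    (by exact (by fun_prop)) i
  rw [← sphereMean_const_mul, ← sphereMean_const_mul, ← sub_eq_zero,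
    ← sphereMean_sub hn (by fun_prop) (by fun_prop)]
  rw [← sub_eq_zero, ← sphereMean_sub hn] at h
  · rw [← neg_eq_zero, ← h, ← neg_one_mul, ← sphereMean_const_mul]
    refine sphereMean_congr fun x _ => ?_
    rcases b with _ | b
    · simp
      ring
    · simp [hij.symm]
      ring
  · simp [hij.symm]
    fun_prop
  · simp
    fun_prop

lemma sphereMean_coord_mul_pow {n : ℕ} (hn : 2 ≤ n) {i j : Fin n} (hij : i ≠ j) (b : ℕ) :
    sphereMean (fun x : EuclideanSpace ℝ (Fin n) => x i * x j ^ b) = 0 := by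
  have hi := continuous_coord i
  have hj := continuous_coord j
  have h := sphereMean_integration_by_parts (by omega)
    (fun x => hasFDerivAt_comp_coord (fun t => hasDerivAt_pow b t) j x)
    (by exact (by fun_prop)) i
  have h2 : sphereMean (fun x : EuclideanSpace ℝ (Fin n) =>
      ((n : ℝ) - 1 + b) * (x i * x j ^ b)) = 0 := by
    trans sphereMean (fun _ : EuclideanSpace ℝ (Fin n) => (0 : ℝ))
    · refine Eq.trans (sphereMean_congr fun x _ => ?_)
        (h.symm.trans (sphereMean_congr fun x _ => ?_))
      · rcases b with _ | b
        · simp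
        · simp
          ring
      · simp [hij.symm]
    · exact sphereMean_const (by omega) 0
  rw [sphereMean_const_mul] at h2
  rcases mul_eq_zero.1 h2 with h3 | h3
  · have : (2 : ℝ) ≤ n := by exact_mod_cast hn
    have : (0 : ℝ) ≤ b := by positivity
    linarith
  · exact h3

lemma sphereMean_coord_pow {n : ℕ} (hn : 1 ≤ n) (i : Fin n) (a : ℕ) :
    ((n : ℝ) + a) * sphereMean (fun x : EuclideanSpace ℝ (Fin n) => x i ^ (a + 2)) =
      (a + 1) * sphereMean (fun x : EuclideanSpace ℝ (Fin n) => x i ^ a) := by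
  have h := sphereMean_coord_integration_by_parts hn (Polynomial.X ^ (a + 1)) i
  have hi := continuous_coord i
  rw [← sphereMean_const_mul, ← sub_eq_zero, ← sphereMean_sub hn] at h
  · rw [← sphereMean_const_mul, ← sphereMean_const_mul, ← sub_eq_zero,
      ← sphereMean_sub hn (by fun_prop) (by fun_prop), ← neg_eq_zero, ← h, ← neg_one_mul,
      ← sphereMean_const_mul]
    refine sphereMean_congr fun x _ => ?_
    simp
    ring
  · simp
    fun_prop
  · simp
    fun_prop

lemma sphereMean_coord {n : ℕ} (hn : 2 ≤ n) (i : Fin n) :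
    sphereMean (fun x : EuclideanSpace ℝ (Fin n) => x i) = 0 := by
  have h := sphereMean_coord_integration_by_parts (by omega) (Polynomial.C 1) i
  simp only [Polynomial.derivative_C, Polynomial.eval_zero, mul_zero, Polynomial.eval_C,
    mul_one, sphereMean_const (show 1 ≤ n by omega)] at h
  have : (2 : ℝ) ≤ n := by exact_mod_cast hn
  rcases mul_eq_zero.1 h.symm with h3 | h3
  · linarith
  · exact h3

lemma abs_sphereMean_coord_pow_le {n : ℕ} (hn : 2 ≤ n) (i : Fin n) (a : ℕ) :
    |sphereMean (fun x : EuclideanSpace ℝ (Fin n) => x i ^ a)| * √n ^ a ≤ a.factorial := by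
  have hn1 : 1 ≤ n := by omega
  have hn0 : (0 : ℝ) < n := by positivity
  induction a using Nat.twoStepInduction with
  | zero => simp [sphereMean_const hn1]
  | one => simp [sphereMean_coord hn]
  | more a ih _ =>
    have h := sphereMean_coord_pow hn1 i a
    set M := sphereMean (fun x : EuclideanSpace ℝ (Fin n) => x i ^ a)
    set M2 := sphereMean (fun x : EuclideanSpace ℝ (Fin n) => x i ^ (a + 2))
    have ha : (0 : ℝ) ≤ a := by positivity
    have h1 : n * |M2| ≤ (a + 1) * |M| := by
      have := congrArg abs h
      rw [abs_mul, abs_mul, abs_of_nonneg (by positivity : (0 : ℝ) ≤ n + a),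
        abs_of_nonneg (by positivity : (0 : ℝ) ≤ a + 1)] at this
      nlinarith [abs_nonneg M2]
    have hs : √(n : ℝ) ^ (a + 2) = √n ^ a * n := by
      rw [pow_add, sq_sqrt hn0.le]
    rw [hs, Nat.factorial_succ, Nat.factorial_succ]
    push_cast
    have hs0 : 0 ≤ √(n : ℝ) ^ a := by positivity
    calc |M2| * (√n ^ a * n) = (n * |M2|) * √n ^ a := by ring
      _ ≤ ((a + 1) * |M|) * √n ^ a := by gcongr
      _ = (a + 1) * (|M| * √n ^ a) := by ring
      _ ≤ (a + 1) * a.factorial := by gcongr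
      _ ≤ (a + 1 + 1) * ((a + 1) * a.factorial) := by
        have : (0 : ℝ) ≤ (a + 1) * a.factorial := by positivity
        nlinarith

/-- Two distinct coordinates of a uniform point of the sphere are almost uncorrelated. -/
lemma abs_sphereMean_pow_mul_pow_sub_le {n : ℕ} (hn : 2 ≤ n) {i j : Fin n} (hij : i ≠ j)
    (a b : ℕ) :
    |sphereMean (fun x : EuclideanSpace ℝ (Fin n) => x i ^ a * x j ^ b) -
        sphereMean (fun x : EuclideanSpace ℝ (Fin n) => x i ^ a) *
          sphereMean (fun x : EuclideanSpace ℝ (Fin n) => x j ^ b)| * (√n ^ a * √n ^ b * n) ≤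
      (a * a.factorial) * (b * b.factorial) := by
  have hn1 : 1 ≤ n := by omega
  have hn0 : (0 : ℝ) < n := by positivity
  have hb := abs_sphereMean_coord_pow_le hn j b
  set N := sphereMean (fun x : EuclideanSpace ℝ (Fin n) => x j ^ b) with hN
  induction a using Nat.twoStepInduction with
  | zero => simp [sphereMean_const hn1, ← hN]
  | one =>
    simp only [pow_one, sphereMean_coord_mul_pow hn hij, sphereMean_coord hn]
    simp
    positivity
  | more a ih _ =>
    have h := sphereMean_coord_pow hn1 i a
    have hc := sphereMean_pow_mul_pow hn1 hij a b
    have hM := abs_sphereMean_coord_pow_le hn i a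
    set M := sphereMean (fun x : EuclideanSpace ℝ (Fin n) => x i ^ a)
    set M2 := sphereMean (fun x : EuclideanSpace ℝ (Fin n) => x i ^ (a + 2))
    set c := sphereMean (fun x : EuclideanSpace ℝ (Fin n) => x i ^ a * x j ^ b)
    set c2 := sphereMean (fun x : EuclideanSpace ℝ (Fin n) => x i ^ (a + 2) * x j ^ b)
    have ha : (0 : ℝ) ≤ a := by positivity
    have hb0 : (0 : ℝ) ≤ b := by positivity
    have h1 : (n : ℝ) * n * |c2 - M2 * N| ≤
        (a + 1) * (n * |c - M * N|) + (a + 1) * b * (|M| * |N|) := by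
      have e1 : ((n : ℝ) + a) * (n + a + b) * (c2 - M2 * N) =
          (a + 1) * ((n + a) * (c - M * N)) - (a + 1) * b * (M * N) := by
        linear_combination ((n : ℝ) + a) * hc - (n + a + b) * N * h
      have e2 : ((n : ℝ) + a) * (n * |c2 - M2 * N|) ≤
          (n + a) * ((a + 1) * |c - M * N|) + (a + 1) * b * (|M| * |N|) := by
        calc ((n : ℝ) + a) * (n * |c2 - M2 * N|)
            ≤ (n + a) * ((n + a + b) * |c2 - M2 * N|) := by
              gcongr
              linarith
          _ = |((n : ℝ) + a) * (n + a + b) * (c2 - M2 * N)| := by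
              rw [abs_mul, abs_of_nonneg (by positivity : 0 ≤ ((n : ℝ) + a) * (n + a + b))]
              ring
          _ ≤ |(a + 1) * ((n + a) * (c - M * N))| + |(a + 1) * b * (M * N)| := by
              rw [e1]
              exact abs_sub _ _
          _ = _ := by
              simp only [abs_mul, abs_of_nonneg hb0,
                abs_of_nonneg (by positivity : (0 : ℝ) ≤ n + a),
                abs_of_nonneg (by positivity : (0 : ℝ) ≤ a + 1)]
              ring
      have hP : 0 ≤ (a + 1) * b * (|M| * |N|) := by positivity
      have e3 : n * |c2 - M2 * N| ≤ (a + 1) * |c - M * N| + (a + 1) * b * (|M| * |N|) / n := by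
        have e4 : ((n : ℝ) + a) * (n * |c2 - M2 * N|) ≤ (n + a) * ((a + 1) * |c - M * N| +
            (a + 1) * b * (|M| * |N|) / n) := by
          refine e2.trans ?_
          rw [mul_add]
          refine add_le_add_right ?_ _
          rw [mul_div_assoc', le_div_iff₀ hn0]
          nlinarith
        exact le_of_mul_le_mul_left e4 (by positivity)
      calc (n : ℝ) * n * |c2 - M2 * N| = n * (n * |c2 - M2 * N|) := by ring
        _ ≤ n * ((a + 1) * |c - M * N| + (a + 1) * b * (|M| * |N|) / n) := by gcongr
        _ = _ := by field_simp
    have hs : √(n : ℝ) ^ (a + 2) = √n ^ a * n := by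
      rw [pow_add, sq_sqrt hn0.le]
    rw [hs, Nat.factorial_succ, Nat.factorial_succ]
    push_cast
    set sa := √(n : ℝ) ^ a
    set sb := √(n : ℝ) ^ b
    have hsa : 0 ≤ sa := by positivity
    have hsb : 0 ≤ sb := by positivity
    set A : ℝ := (a.factorial : ℝ)
    set B : ℝ := (b.factorial : ℝ)
    have hA : 0 ≤ A := by positivity
    have hB : 0 ≤ B := by positivity
    calc |c2 - M2 * N| * (sa * n * sb * n) = (n * n * |c2 - M2 * N|) * (sa * sb) := by ring
      _ ≤ ((a + 1) * (n * |c - M * N|) + (a + 1) * b * (|M| * |N|)) * (sa * sb) := by gcongr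
      _ = (a + 1) * (|c - M * N| * (sa * sb * n)) + (a + 1) * b * ((|M| * sa) * (|N| * sb)) := by
        ring
      _ ≤ (a + 1) * (a * A * (b * B)) + (a + 1) * b * (A * B) := by gcongr
      _ = (a + 1) * ((a + 1) * A) * (b * B) := by ring
      _ ≤ (a + 2) * ((a + 1 + 1) * ((a + 1) * A)) * (b * B) := by
        gcongr
        · linarith
        · linarith
        · nlinarith [mul_nonneg ha hA]

/-- `q` has degree at most `d` and its `k`-th coefficient is at most `B * s ^ k`. -/
def CoeffBound (s B : ℝ) (d : ℕ) (q : Polynomial ℝ) : Prop :=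
  q.natDegree ≤ d ∧ ∀ k, |q.coeff k| ≤ B * s ^ k

lemma CoeffBound.nonneg {s B : ℝ} {d : ℕ} {q : Polynomial ℝ} (h : CoeffBound s B d q) : 0 ≤ B := by
  simpa using (abs_nonneg _).trans (h.2 0)

lemma CoeffBound.mul {s B B' : ℝ} {d d' : ℕ} {q r : Polynomial ℝ} (hs : 0 ≤ s)
    (hq : CoeffBound s B d q) (hr : CoeffBound s B' d' r) :
    CoeffBound s ((d + d' + 1) * B * B') (d + d') (q * r) := by
  have hdeg := Polynomial.natDegree_mul_le_of_le hq.1 hr.1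
  have hB := hq.nonneg
  have hB' := hr.nonneg
  refine ⟨hdeg, fun k => ?_⟩
  by_cases hk : k ≤ d + d'
  · rw [Polynomial.coeff_mul]
    calc |∑ x ∈ antidiagonal k, q.coeff x.1 * r.coeff x.2|
        ≤ ∑ x ∈ antidiagonal k, |q.coeff x.1 * r.coeff x.2| := abs_sum_le_sum_abs _ _
      _ ≤ ∑ x ∈ antidiagonal k, B * B' * s ^ k := by
        refine sum_le_sum fun x hx => ?_
        rw [← mem_antidiagonal.1 hx, abs_mul, pow_add]
        calc _ ≤ (B * s ^ x.1) * (B' * s ^ x.2) :=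
              mul_le_mul (hq.2 _) (hr.2 _) (abs_nonneg _) (by positivity)
          _ = _ := by ring
      _ = (k + 1) * (B * B' * s ^ k) := by simp
      _ ≤ (d + d' + 1) * (B * B' * s ^ k) := by
        gcongr
        exact_mod_cast hk
      _ = _ := by ring
  · rw [Polynomial.coeff_eq_zero_of_natDegree_lt (by omega), abs_zero]
    positivity

lemma CoeffBound.const_mul {s B : ℝ} {d : ℕ} {q : Polynomial ℝ} (hq : CoeffBound s B d q) (r : ℝ) :
    CoeffBound s (|r| * B) d (Polynomial.C r * q) := by
  refine ⟨(Polynomial.natDegree_C_mul_le _ _).trans hq.1, fun k => ?_⟩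
  rw [Polynomial.coeff_C_mul, abs_mul, mul_assoc]
  exact mul_le_mul_of_nonneg_left (hq.2 k) (abs_nonneg _)

lemma CoeffBound.mono {s B B' : ℝ} {d : ℕ} {q : Polynomial ℝ} (hs : 0 ≤ s)
    (hq : CoeffBound s B d q) (h : B ≤ B') : CoeffBound s B' d q :=
  ⟨hq.1, fun k => (hq.2 k).trans (by gcongr)⟩

lemma CoeffBound.derivative {s B : ℝ} {d : ℕ} {q : Polynomial ℝ} (hs : 0 ≤ s)
    (hq : CoeffBound s B d q) : CoeffBound s (d * B * s) d q.derivative := by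
  have hB := hq.nonneg
  refine ⟨(Polynomial.natDegree_derivative_le q).trans (by have := hq.1; omega), fun k => ?_⟩
  rw [Polynomial.coeff_derivative]
  by_cases hk : k + 1 ≤ d
  · rw [abs_mul, abs_of_nonneg (by positivity : (0 : ℝ) ≤ k + 1)]
    calc |q.coeff (k + 1)| * (k + 1) ≤ (B * s ^ (k + 1)) * d := by
          gcongr
          · exact hq.2 _
          · exact_mod_cast hk
      _ = _ := by ring
  · rw [Polynomial.coeff_eq_zero_of_natDegree_lt (by have := hq.1; omega), zero_mul, abs_zero]
    positivity

lemma CoeffBound.X_mul {s B : ℝ} {d : ℕ} {q : Polynomial ℝ} (hs : 0 < s)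
    (hq : CoeffBound s B d q) : CoeffBound s (B / s) (d + 1) (Polynomial.X * q) := by
  have hB := hq.nonneg
  refine ⟨(Polynomial.natDegree_mul_le_of_le Polynomial.natDegree_X_le hq.1).trans (by omega),
    fun k => ?_⟩
  rcases k with _ | k
  · simp
    positivity
  · rw [Polynomial.coeff_X_mul]
    refine (hq.2 k).trans (le_of_eq ?_)
    field_simp
    ring

lemma CoeffBound.abs_sphereMean_le {n : ℕ} (hn : 2 ≤ n) {B : ℝ} {d : ℕ} {q : Polynomial ℝ}
    (hq : CoeffBound √n B d q) (i : Fin n) :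
    |sphereMean (fun x : EuclideanSpace ℝ (Fin n) => q.eval (x i))| ≤
      (d + 1) * d.factorial * B := by
  have hi := continuous_coord i
  have hB := hq.nonneg
  simp only [Polynomial.eval_eq_sum_range' (Nat.lt_succ_of_le hq.1)]
  rw [sphereMean_sum (by omega) _ fun k _ => by fun_prop]
  simp only [sphereMean_const_mul]
  calc _ ≤ ∑ k ∈ range (d + 1), |q.coeff k *
          sphereMean (fun x : EuclideanSpace ℝ (Fin n) => x i ^ k)| := abs_sum_le_sum_abs _ _
    _ ≤ ∑ k ∈ range (d + 1), d.factorial * B := by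
      refine sum_le_sum fun k hk => ?_
      have hf : (k.factorial : ℝ) ≤ d.factorial := by
        exact_mod_cast Nat.factorial_le (Nat.lt_succ_iff.1 (mem_range.1 hk))
      rw [abs_mul]
      calc _ ≤ (B * √n ^ k) * |sphereMean (fun x : EuclideanSpace ℝ (Fin n) => x i ^ k)| := by
            gcongr
            exact hq.2 k
        _ = (|sphereMean (fun x : EuclideanSpace ℝ (Fin n) => x i ^ k)| * √n ^ k) * B := by ring
        _ ≤ d.factorial * B := by
            gcongr
            exact (abs_sphereMean_coord_pow_le hn i k).trans hf
    _ = _ := by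
      simp
      ring

lemma CoeffBound.abs_covariance_le {n : ℕ} (hn : 2 ≤ n) {B : ℝ} {d : ℕ} {q : Polynomial ℝ}
    (hq : CoeffBound √n B d q) {i j : Fin n} (hij : i ≠ j) :
    |sphereMean (fun x : EuclideanSpace ℝ (Fin n) => q.eval (x i) * q.eval (x j)) -
        sphereMean (fun x : EuclideanSpace ℝ (Fin n) => q.eval (x i)) *
          sphereMean (fun x : EuclideanSpace ℝ (Fin n) => q.eval (x j))| ≤
      ((d + 1) * (d * d.factorial) * B) ^ 2 / n := by
  have hi := continuous_coord i
  have hj := continuous_coord j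
  have hB := hq.nonneg
  have hn1 : 1 ≤ n := by omega
  have hn0 : (0 : ℝ) < n := by positivity
  simp only [Polynomial.eval_eq_sum_range' (Nat.lt_succ_of_le hq.1), sum_mul_sum]
  rw [sphereMean_sum hn1 _ fun k _ => by fun_prop, sphereMean_sum hn1 _ fun k _ => by fun_prop,
    sphereMean_sum hn1 _ fun k _ => by fun_prop, sum_mul_sum, ← sum_sub_distrib]
  have hterm : ∀ k ∈ range (d + 1), ∀ l ∈ range (d + 1),
      |sphereMean (fun x : EuclideanSpace ℝ (Fin n) =>
          q.coeff k * x i ^ k * (q.coeff l * x j ^ l)) -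
        sphereMean (fun x : EuclideanSpace ℝ (Fin n) => q.coeff k * x i ^ k) *
          sphereMean (fun x : EuclideanSpace ℝ (Fin n) => q.coeff l * x j ^ l)| ≤
        (d * d.factorial * B) ^ 2 / n := by
    intro k hk l hl
    have hfac : ∀ m ∈ range (d + 1), (m * m.factorial : ℝ) ≤ d * d.factorial := by
      intro m hm
      have hm' := Nat.lt_succ_iff.1 (mem_range.1 hm)
      exact_mod_cast Nat.mul_le_mul hm' (Nat.factorial_le hm')
    have e : (fun x : EuclideanSpace ℝ (Fin n) => q.coeff k * x i ^ k * (q.coeff l * x j ^ l)) =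
        fun x => (q.coeff k * q.coeff l) * (x i ^ k * x j ^ l) := by
      ext x
      ring
    rw [e, sphereMean_const_mul, sphereMean_const_mul, sphereMean_const_mul, mul_mul_mul_comm,
      ← mul_sub, abs_mul, abs_mul, le_div_iff₀ hn0]
    have h := abs_sphereMean_pow_mul_pow_sub_le hn hij k l
    set D := |sphereMean (fun x : EuclideanSpace ℝ (Fin n) => x i ^ k * x j ^ l) -
        sphereMean (fun x : EuclideanSpace ℝ (Fin n) => x i ^ k) *
          sphereMean (fun x : EuclideanSpace ℝ (Fin n) => x j ^ l)|
    have hD : 0 ≤ D := abs_nonneg _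
    calc |q.coeff k| * |q.coeff l| * D * n ≤ (B * √n ^ k) * (B * √n ^ l) * D * n := by
          gcongr
          · exact hq.2 k
          · exact hq.2 l
      _ = B ^ 2 * (D * (√n ^ k * √n ^ l * n)) := by ring
      _ ≤ B ^ 2 * ((k * k.factorial) * (l * l.factorial)) := by gcongr
      _ ≤ B ^ 2 * ((d * d.factorial) * (d * d.factorial)) := by
          gcongr B ^ 2 * (?_ * ?_)
          · exact hfac k hk
          · exact hfac l hl
      _ = _ := by ring
  calc _ ≤ ∑ k ∈ range (d + 1), ∑ l ∈ range (d + 1), (d * d.factorial * B) ^ 2 / n := by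
        refine (abs_sum_le_sum_abs _ _).trans (sum_le_sum fun k hk => ?_)
        rw [sphereMean_sum hn1 _ fun k _ => by fun_prop, ← sum_sub_distrib]
        exact (abs_sum_le_sum_abs _ _).trans (sum_le_sum fun l hl => hterm k hk l hl)
    _ = _ := by
      simp
      ring

/-- The coefficient of `t ^ (m - 2 * j)` in the Gegenbauer polynomial `C^k_m(t)`. -/
def gegenbauerCoeff (k : ℝ) (m j : ℕ) : ℝ :=
  2 ^ m / Gamma k * ((-1) ^ j * Gamma (k + m - j) /
    (2 ^ (2 * j) * (Nat.factorial j) * (Nat.factorial (m - 2 * j))))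

/-- The Gegenbauer polynomial `C^k_m` as a formal polynomial. -/
def gegenbauerPoly (k : ℝ) (m : ℕ) : Polynomial ℝ :=
  ∑ j ∈ range (m / 2 + 1), Polynomial.C (gegenbauerCoeff k m j) * Polynomial.X ^ (m - 2 * j)

lemma eval_gegenbauerPoly (k : ℝ) (m : ℕ) (t : ℝ) :
    (gegenbauerPoly k m).eval t = gegenbauer k m t := by
  simp only [gegenbauerPoly, gegenbauer, Polynomial.eval_finsetSum, mul_sum]
  refine sum_congr rfl fun j _ => ?_
  simp only [gegenbauerCoeff, Polynomial.eval_mul, Polynomial.eval_C, Polynomial.eval_pow,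
    Polynomial.eval_X]
  ring

lemma gegenbauerCoeff_succ {k : ℝ} (hk : 0 < k) {m j d : ℕ} (hd : m - 2 * j = d + 2) :
    ((d : ℝ) + 2) * (d + 1) * gegenbauerCoeff k m j +
      4 * (j + 1) * (m - (j + 1) + k) * gegenbauerCoeff k m (j + 1) = 0 := by
  have hd' : m - 2 * (j + 1) = d := by omega
  have hm : (m : ℝ) = d + 2 + 2 * j := by
    have : m = d + 2 + 2 * j := by omega
    rw [this]
    push_cast
    ring
  have hG : Gamma (k + m - j) = (k + m - (j + 1)) * Gamma (k + m - (j + 1)) := by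
    rw [← Real.Gamma_add_one]
    · congr 1
      ring
    · rw [hm]
      have : (0 : ℝ) ≤ d := by positivity
      have : (0 : ℝ) ≤ j := by positivity
      exact ne_of_gt (by linarith)
  have hGk := (Gamma_pos_of_pos hk).ne'
  simp only [gegenbauerCoeff, hd, hd', Nat.factorial_succ]
  push_cast
  rw [hG]
  field_simp
  ring

/-- The Gegenbauer differential equation. -/
lemma gegenbauerPoly_ode {k : ℝ} (hk : 0 < k) (m : ℕ) :
    (1 - Polynomial.X ^ 2) * (gegenbauerPoly k m).derivative.derivative -
      Polynomial.C (2 * k + 1) * Polynomial.X * (gegenbauerPoly k m).derivative +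
      Polynomial.C (m * (m + 2 * k)) * gegenbauerPoly k m = 0 := by
  set a : ℕ → Polynomial ℝ := fun j =>
    Polynomial.C (gegenbauerCoeff k m j * ((m - 2 * j : ℕ) * ((m - 2 * j : ℕ) - 1))) *
      Polynomial.X ^ (m - 2 * j - 2) with ha
  set b : ℕ → Polynomial ℝ := fun j =>
    Polynomial.C (4 * j * (m - j + k) * gegenbauerCoeff k m j) * Polynomial.X ^ (m - 2 * j) with hb
  have hsum : (1 - Polynomial.X ^ 2) * (gegenbauerPoly k m).derivative.derivative -
      Polynomial.C (2 * k + 1) * Polynomial.X * (gegenbauerPoly k m).derivative +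
      Polynomial.C (m * (m + 2 * k)) * gegenbauerPoly k m =
      ∑ j ∈ range (m / 2 + 1), (a j + b j) := by
    simp only [gegenbauerPoly, Polynomial.derivative_sum, mul_sum, ← sum_sub_distrib,
      ← sum_add_distrib]
    refine sum_congr rfl fun j hj => ?_
    have hjm : 2 * j ≤ m := by
      have := mem_range.1 hj
      omega
    have hm : (m : ℝ) = (m - 2 * j : ℕ) + 2 * j := by
      rw [Nat.cast_sub hjm]
      push_cast
      ring
    simp only [ha, hb]
    rw [hm]
    generalize m - 2 * j = d
    generalize gegenbauerCoeff k m j = c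
    have c2 : (Polynomial.C 2 : Polynomial ℝ) = 2 := rfl
    have c4 : (Polynomial.C 4 : Polynomial ℝ) = 4 := rfl
    rcases d with _ | _ | d
    · simp [c2, c4]
      left
      ring
    · simp [c2, c4]
      ring
    · simp [c2, c4]
      ring
  have hab : ∀ j ∈ range (m / 2), a j + b (j + 1) = 0 := by
    intro j hj
    have hj' := mem_range.1 hj
    obtain ⟨d, hd⟩ : ∃ d, m - 2 * j = d + 2 := ⟨m - 2 * j - 2, by omega⟩
    have hd' : m - 2 * (j + 1) = d := by omega
    have h := gegenbauerCoeff_succ hk hd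
    simp only [ha, hb, hd, hd', Nat.add_sub_cancel, ← add_mul, ← Polynomial.C_add]
    push_cast
    rw [show gegenbauerCoeff k m j * (((d : ℝ) + 2) * (d + 2 - 1)) +
      4 * (j + 1) * (m - (j + 1) + k) * gegenbauerCoeff k m (j + 1) = 0 by linarith]
    simp
  have haN : a (m / 2) = 0 := by
    obtain h | h : m - 2 * (m / 2) = 0 ∨ m - 2 * (m / 2) = 1 := by omega
    · simp [ha, h]
    · simp [ha, h]
  have hb0 : b 0 = 0 := by simp [hb]
  rw [hsum, sum_add_distrib, sum_range_succ, sum_range_succ', haN, hb0, add_zero, add_zero,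
    ← sum_add_distrib, sum_eq_zero hab]

lemma iterate_derivative_gegenbauerPoly_ode {k : ℝ} (hk : 0 < k) (m r : ℕ) :
    (1 - Polynomial.X ^ 2) *
        (Polynomial.derivative^[r] (gegenbauerPoly k m)).derivative.derivative -
      Polynomial.C (2 * k + 1 + 2 * r) * Polynomial.X *
        (Polynomial.derivative^[r] (gegenbauerPoly k m)).derivative +
      Polynomial.C ((m - r) * (m + r + 2 * k)) *
        Polynomial.derivative^[r] (gegenbauerPoly k m) = 0 := by
  induction r with
  | zero => simpa using gegenbauerPoly_ode hk m
  | succ r ih =>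
    rw [Function.iterate_succ_apply']
    set y := Polynomial.derivative^[r] (gegenbauerPoly k m)
    have h := congrArg Polynomial.derivative ih
    simp only [Polynomial.derivative_add, Polynomial.derivative_sub, Polynomial.derivative_mul,
      Polynomial.derivative_one, Polynomial.derivative_X_pow, Polynomial.derivative_C,
      Polynomial.derivative_X, Polynomial.derivative_zero] at h
    have e1 : Polynomial.C (2 * k + 1 + 2 * ((r + 1 : ℕ) : ℝ)) =
        Polynomial.C (2 * k + 1 + 2 * (r : ℝ)) + 2 := by
      rw [← Polynomial.C_ofNat, ← Polynomial.C_add]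
      congr 1
      push_cast
      ring
    have e2 : Polynomial.C (((m : ℝ) - (r + 1 : ℕ)) * (m + (r + 1 : ℕ) + 2 * k)) =
        Polynomial.C (((m : ℝ) - r) * (m + r + 2 * k)) -
          Polynomial.C (2 * k + 1 + 2 * (r : ℝ)) := by
      rw [← Polynomial.C_sub]
      congr 1
      push_cast
      ring
    have e3 : (Polynomial.C ((2 : ℕ) : ℝ) : Polynomial ℝ) = 2 := by simp; rfl
    rw [e1, e2]
    rw [e3] at h
    linear_combination h

lemma sphereMean_eq_of_sub_eq {n : ℕ} (hn : 1 ≤ n) {F G F' G' : EuclideanSpace ℝ (Fin n) → ℝ}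
    (h : sphereMean F' = sphereMean G') (hF : Continuous F) (hG : Continuous G)
    (hF' : Continuous F') (hG' : Continuous G') (hsub : ∀ x, F x - G x = F' x - G' x) :
    sphereMean F = sphereMean G := by
  rw [← sub_eq_zero, ← sphereMean_sub hn hF' hG'] at h
  rw [← sub_eq_zero, ← sphereMean_sub hn hF hG, ← h]
  exact sphereMean_congr fun x _ => hsub x

lemma sphereMean_weighted_derivative_sq {n : ℕ} (hn : 1 ≤ n) (i : Fin n) (r : ℕ) (κ : ℝ)
    {y : Polynomial ℝ}
    (hy : (1 - Polynomial.X ^ 2) * y.derivative.derivative -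
      Polynomial.C ((n : ℝ) - 1 + 2 * r) * Polynomial.X * y.derivative + Polynomial.C κ * y = 0) :
    sphereMean (fun x : EuclideanSpace ℝ (Fin n) =>
        (1 - x i ^ 2) ^ (r + 1) * y.derivative.eval (x i) ^ 2) =
      κ * sphereMean (fun x : EuclideanSpace ℝ (Fin n) =>
        (1 - x i ^ 2) ^ r * y.eval (x i) ^ 2) := by
  have h := sphereMean_coord_integration_by_parts hn
    ((1 - Polynomial.X ^ 2) ^ r * (y * y.derivative)) i
  have hi := continuous_coord i
  have h0 := continuous_eval_coord y i
  have h1 := continuous_eval_coord y.derivative i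
  have h2 := continuous_eval_coord y.derivative.derivative i
  have h3 := fun q => continuous_eval_coord q i
  rw [← sphereMean_const_mul] at h ⊢
  refine sphereMean_eq_of_sub_eq hn h (by fun_prop) (by fun_prop) (by fun_prop) (by fun_prop)
    fun x => ?_
  have hyx := congrArg (Polynomial.eval (x i)) hy
  simp at hyx
  rcases r with _ | r
  · simp at hyx ⊢
    linear_combination -(y.eval (x i)) * hyx
  · simp [Polynomial.derivative_pow] at hyx ⊢
    linear_combination -(1 - x i ^ 2) ^ (r + 1) * (y.eval (x i)) * hyx

lemma sphereMean_one_sub_sq_pow {n : ℕ} (hn : 1 ≤ n) (i : Fin n) (r : ℕ) :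
    sphereMean (fun x : EuclideanSpace ℝ (Fin n) => (1 - x i ^ 2) ^ r) =
      ∏ l ∈ range r, (((n : ℝ) - 1 + 2 * l) / (n + 2 * l)) := by
  induction r with
  | zero => simp [sphereMean_const hn]
  | succ r ih =>
    rw [prod_range_succ, ← ih]
    have hi := continuous_coord i
    have h := sphereMean_coord_integration_by_parts hn
      (Polynomial.X * (1 - Polynomial.X ^ 2) ^ r) i
    rw [← sphereMean_const_mul] at h
    have h3 := fun q => continuous_eval_coord q i
    have hn0 : (0 : ℝ) < n + 2 * r := by positivity
    rw [mul_div_assoc', eq_div_iff hn0.ne', mul_comm, mul_comm _ ((n : ℝ) - 1 + 2 * r),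
      ← sphereMean_const_mul, ← sphereMean_const_mul]
    refine sphereMean_eq_of_sub_eq hn h (by fun_prop) (by fun_prop) (by fun_prop) (by fun_prop)
      fun x => ?_
    rcases r with _ | r
    · simp
      ring
    · simp [Polynomial.derivative_pow]
      ring

lemma Gamma_add_nat_eq {k : ℝ} (hk : 0 < k) (m : ℕ) :
    Gamma (k + m) = (∏ i ∈ range m, (k + i)) * Gamma k := by
  induction m with
  | zero => simp
  | succ m ih =>
    have h : k + m ≠ 0 := by positivity
    rw [prod_range_succ, Nat.cast_succ, ← add_assoc, Gamma_add_one h, ih]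
    ring

lemma natDegree_gegenbauerPoly_le (k : ℝ) (m : ℕ) : (gegenbauerPoly k m).natDegree ≤ m := by
  refine Polynomial.natDegree_sum_le_of_forall_le _ _ fun j _ => ?_
  exact (Polynomial.natDegree_C_mul_X_pow_le _ _).trans (Nat.sub_le _ _)

lemma factorial_mul_coeff_gegenbauerPoly {k : ℝ} (hk : 0 < k) (m : ℕ) :
    m.factorial * (gegenbauerPoly k m).coeff m = ∏ i ∈ range m, (2 * k + 2 * i) := by
  have h : (gegenbauerPoly k m).coeff m = gegenbauerCoeff k m 0 := by
    rw [gegenbauerPoly, Polynomial.finsetSum_coeff, sum_eq_single_of_mem 0 (by simp)]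
    · simp
    · intro j hj hj0
      have := mem_range.1 hj
      rw [Polynomial.coeff_C_mul_X_pow, if_neg (by omega)]
  have hG := (Gamma_pos_of_pos hk).ne'
  have hm : (m.factorial : ℝ) ≠ 0 := by positivity
  rw [h, gegenbauerCoeff]
  simp only [Nat.cast_zero, sub_zero, Gamma_add_nat_eq hk]
  simp only [← mul_add, prod_mul_distrib, prod_const, card_range]
  simp
  field_simp

lemma sphereMean_gegenbauerPoly_sq {n : ℕ} (hn : 3 ≤ n) (i : Fin n) (m : ℕ) :
    (∏ r ∈ range m, (((m : ℝ) - r) * (m + r + (n - 2)))) *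
        sphereMean (fun x : EuclideanSpace ℝ (Fin n) =>
          (gegenbauerPoly (((n : ℝ) - 2) / 2) m).eval (x i) ^ 2) =
      (∏ r ∈ range m, ((n : ℝ) - 2 + 2 * r)) ^ 2 *
        ∏ r ∈ range m, (((n : ℝ) - 1 + 2 * r) / (n + 2 * r)) := by
  have hk : 0 < ((n : ℝ) - 2) / 2 := by
    have : (3 : ℝ) ≤ n := by exact_mod_cast hn
    linarith
  set P := gegenbauerPoly (((n : ℝ) - 2) / 2) m with hP
  have hstep : ∀ s, sphereMean (fun x : EuclideanSpace ℝ (Fin n) =>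
      (1 - x i ^ 2) ^ s * (Polynomial.derivative^[s] P).eval (x i) ^ 2) =
      (∏ r ∈ range s, (((m : ℝ) - r) * (m + r + (n - 2)))) *
        sphereMean (fun x : EuclideanSpace ℝ (Fin n) => P.eval (x i) ^ 2) := by
    intro s
    induction s with
    | zero => simp
    | succ s ih =>
      rw [prod_range_succ, mul_right_comm, ← ih, mul_comm, Function.iterate_succ_apply']
      refine sphereMean_weighted_derivative_sq (by omega) i s _ ?_
      have := iterate_derivative_gegenbauerPoly_ode hk m s
      rw [← hP] at this
      convert this using 5
      · ring_nf
      · ring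
  have hconst : Polynomial.derivative^[m] P =
      Polynomial.C (∏ r ∈ range m, ((n : ℝ) - 2 + 2 * r)) := by
    have hd : (Polynomial.derivative^[m] P).natDegree = 0 := by
      have h1 := Polynomial.natDegree_iterate_derivative P m
      have h2 := natDegree_gegenbauerPoly_le (((n : ℝ) - 2) / 2) m
      rw [← hP] at h2
      omega
    rw [Polynomial.eq_C_of_natDegree_eq_zero hd, Polynomial.coeff_iterate_derivative]
    congr 1
    rw [zero_add, Nat.descFactorial_self, nsmul_eq_mul, factorial_mul_coeff_gegenbauerPoly hk]
    refine prod_congr rfl fun r _ => ?_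
    ring
  rw [← hstep m, hconst, ← sphereMean_one_sub_sq_pow (by omega) i, ← sphereMean_const_mul]
  refine sphereMean_congr fun x _ => ?_
  simp only [Polynomial.eval_C]
  ring

/-- The polynomial `A_{n,ℓ} C^{(n-2)/2}_ℓ`, so that `p_ℓ^{(i)}(x)` is its value at `x_i`. -/
def zonalPoly (n m : ℕ) : Polynomial ℝ :=
  Polynomial.C (Aconst n m) * gegenbauerPoly (((n : ℝ) - 2) / 2) m

lemma eval_zonalPoly (n m : ℕ) (i : Fin n) (x : EuclideanSpace ℝ (Fin n)) :
    (zonalPoly n m).eval (x i) = pli n m i x := by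
  rw [zonalPoly, Polynomial.eval_mul, Polynomial.eval_C, eval_gegenbauerPoly, pli]

lemma Aconst_sq (N m : ℕ) :
    Aconst (N + 3) m ^ 2 = (N.factorial * m.factorial * ((N : ℝ) + 1 + 2 * m)) /
      ((N + m).factorial * ((N : ℝ) + 1)) := by
  rw [Aconst, show N + 3 - 3 = N by omega, show N + 3 + m - 3 = N + m by omega, sq_sqrt]
  · push_cast
    congr 2 <;> ring
  · push_cast
    have h1 : (0 : ℝ) ≤ (N : ℝ) + 3 + 2 * m - 2 := by
      have : (0 : ℝ) ≤ N := by positivity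
      have : (0 : ℝ) ≤ m := by positivity
      linarith
    have h2 : (0 : ℝ) ≤ (N : ℝ) + 3 - 2 := by
      have : (0 : ℝ) ≤ N := by positivity
      linarith
    positivity

lemma prod_range_sub_eq_factorial (m : ℕ) :
    ∏ r ∈ range m, ((m : ℝ) - r) = m.factorial := by
  rw [← prod_range_reflect, ← prod_range_add_one_eq_factorial]
  push_cast
  refine prod_congr rfl fun r hr => ?_
  have := mem_range.1 hr
  rw [show m - 1 - r = m - (r + 1) by omega, Nat.cast_sub (by omega)]
  push_cast
  ring

lemma factorial_mul_prod_range_add (N m : ℕ) :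
    (N.factorial : ℝ) * ∏ r ∈ range m, ((N : ℝ) + 1 + r) = (N + m).factorial := by
  induction m with
  | zero => simp
  | succ m ih =>
    rw [prod_range_succ, ← mul_assoc, ih, ← add_assoc, Nat.factorial_succ]
    push_cast
    ring

lemma factorial_mul_prod_range_two_mul (N m : ℕ) :
    (N.factorial : ℝ) * ∏ r ∈ range m, (((N : ℝ) + 1 + 2 * r) * (N + 2 + 2 * r)) =
      (N + 2 * m).factorial := by
  induction m with
  | zero => simp
  | succ m ih =>
    rw [prod_range_succ, ← mul_assoc, ih, show N + 2 * (m + 1) = N + 2 * m + 1 + 1 by ring,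
      Nat.factorial_succ, Nat.factorial_succ]
    push_cast
    ring

lemma prod_range_div_telescope (N m : ℕ) :
    ∏ r ∈ range m, (((N : ℝ) + 1 + 2 * r) / (N + 3 + 2 * r)) =
      ((N : ℝ) + 1) / (N + 1 + 2 * m) := by
  induction m with
  | zero =>
    have : (N : ℝ) + 1 ≠ 0 := by positivity
    simp [this]
  | succ m ih =>
    have h1 : (N : ℝ) + 1 + 2 * m ≠ 0 := by positivity
    have h2 : (N : ℝ) + 3 + 2 * m ≠ 0 := by positivity
    have h3 : (N : ℝ) + 1 + 2 * (m + 1 : ℕ) = N + 3 + 2 * m := by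
      push_cast
      ring
    rw [prod_range_succ, ih, h3]
    field_simp

lemma sphereMean_zonalPoly_sq {n : ℕ} (hn : 3 ≤ n) (i : Fin n) (m : ℕ) :
    sphereMean (fun x : EuclideanSpace ℝ (Fin n) => (zonalPoly n m).eval (x i) ^ 2) = 1 := by
  obtain ⟨N, rfl⟩ : ∃ N, n = N + 3 := ⟨n - 3, by omega⟩
  have h := sphereMean_gegenbauerPoly_sq hn i m
  have hL : ((N + m).factorial : ℝ) *
      ∏ r ∈ range m, (((m : ℝ) - r) * (m + r + (((N + 3 : ℕ) : ℝ) - 2))) =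
      m.factorial * (N + 2 * m).factorial := by
    have h1 := factorial_mul_prod_range_add (N + m) m
    rw [show N + m + m = N + 2 * m by ring] at h1
    rw [prod_mul_distrib, prod_range_sub_eq_factorial, ← h1]
    have : ∏ r ∈ range m, ((m : ℝ) + r + (((N + 3 : ℕ) : ℝ) - 2)) =
        ∏ r ∈ range m, (((N + m : ℕ) : ℝ) + 1 + r) := by
      refine prod_congr rfl fun r _ => ?_
      push_cast
      ring
    rw [this]
    ring
  have hR : (N.factorial : ℝ) * ((∏ r ∈ range m, (((N + 3 : ℕ) : ℝ) - 2 + 2 * r)) ^ 2 *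
      ∏ r ∈ range m, ((((N + 3 : ℕ) : ℝ) - 1 + 2 * r) / ((N + 3 : ℕ) + 2 * r))) =
      (N + 2 * m).factorial * (((N : ℝ) + 1) / (N + 1 + 2 * m)) := by
    rw [← factorial_mul_prod_range_two_mul, ← prod_range_div_telescope, mul_assoc,
      ← prod_mul_distrib, ← prod_pow, ← prod_mul_distrib]
    congr 1
    refine prod_congr rfl fun r _ => ?_
    push_cast
    field_simp
    ring
  have hA := Aconst_sq N m
  have hc : (fun x : EuclideanSpace ℝ (Fin (N + 3)) => (zonalPoly (N + 3) m).eval (x i) ^ 2) =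
      fun x => Aconst (N + 3) m ^ 2 *
        (gegenbauerPoly ((((N + 3 : ℕ) : ℝ) - 2) / 2) m).eval (x i) ^ 2 := by
    funext x
    rw [zonalPoly, Polynomial.eval_mul, Polynomial.eval_C, mul_pow]
  rw [hc, sphereMean_const_mul, hA]
  generalize sphereMean (fun x : EuclideanSpace ℝ (Fin (N + 3)) =>
        (gegenbauerPoly ((((N + 3 : ℕ) : ℝ) - 2) / 2) m).eval (x i) ^ 2) = E at *
  generalize ∏ r ∈ range m, (((m : ℝ) - r) * (m + r + (((N + 3 : ℕ) : ℝ) - 2))) = L at *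
  have hkey : (m.factorial : ℝ) * (N + 2 * m).factorial * N.factorial * E =
      (N + m).factorial * ((N + 2 * m).factorial * (((N : ℝ) + 1) / (N + 1 + 2 * m))) := by
    rw [← hL, ← hR, ← h]
    ring
  have f1 : ((N + 2 * m).factorial : ℝ) ≠ 0 := by positivity
  have f2 : ((N + m).factorial : ℝ) ≠ 0 := by positivity
  have f3 : (N : ℝ) + 1 ≠ 0 := by positivity
  have f4 : (N : ℝ) + 1 + 2 * m ≠ 0 := by positivity
  field_simp at hkey ⊢
  linear_combination hkey

lemma Aconst_mul_pow_le {n : ℕ} (hn : 3 ≤ n) (m : ℕ) :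
    Aconst n m * √n ^ m ≤ √(m.factorial * (2 * m + 1) * 3 ^ m) := by
  obtain ⟨N, rfl⟩ : ∃ N, n = N + 3 := ⟨n - 3, by omega⟩
  refine Real.le_sqrt_of_sq_le ?_
  rw [mul_pow, ← pow_mul, mul_comm m 2, pow_mul, sq_sqrt (by positivity), Aconst_sq,
    div_mul_eq_mul_div,
    div_le_iff₀ (by positivity)]
  have h1 : ((N + 3 : ℕ) : ℝ) ^ m ≤ 3 ^ m * ((N : ℝ) + 1) ^ m := by
    rw [← mul_pow]
    refine pow_le_pow_left₀ (by positivity) ?_ m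
    push_cast
    have : (0 : ℝ) ≤ N := by positivity
    linarith
  have h2 : (N.factorial : ℝ) * ((N : ℝ) + 1) ^ m ≤ (N + m).factorial := by
    exact_mod_cast Nat.factorial_mul_pow_le_factorial
  have h3 : (N : ℝ) + 1 + 2 * m ≤ (2 * m + 1) * (N + 1) := by
    have : (0 : ℝ) ≤ (m : ℝ) * N := by positivity
    linarith
  calc (N.factorial : ℝ) * m.factorial * (N + 1 + 2 * m) * ((N + 3 : ℕ) : ℝ) ^ m
      ≤ N.factorial * m.factorial * ((2 * m + 1) * (N + 1)) * (3 ^ m * ((N : ℝ) + 1) ^ m) := by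
        gcongr
    _ = (N.factorial * ((N : ℝ) + 1) ^ m) * (m.factorial * (2 * m + 1) * (N + 1) * 3 ^ m) := by ring
    _ ≤ (N + m).factorial * (m.factorial * (2 * m + 1) * (N + 1) * 3 ^ m) := by gcongr
    _ = _ := by ring

lemma abs_gegenbauerCoeff_le {n : ℕ} (hn : 3 ≤ n) {m j : ℕ} (hj : 2 * j ≤ m) :
    |gegenbauerCoeff (((n : ℝ) - 2) / 2) m j| ≤
      2 ^ m * ((m : ℝ) + 1) ^ m * (√n ^ m * √n ^ (m - 2 * j)) := by
  have hn' : (3 : ℝ) ≤ n := by exact_mod_cast hn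
  have hk : 0 < ((n : ℝ) - 2) / 2 := by linarith
  set k := ((n : ℝ) - 2) / 2 with hkdef
  have hG := Gamma_pos_of_pos hk
  have hcast : k + m - j = k + (m - j : ℕ) := by
    rw [Nat.cast_sub (by omega)]
    ring
  have hprod0 : 0 ≤ ∏ i ∈ range (m - j), (k + i) := prod_nonneg fun i _ => by positivity
  have hprod : ∏ i ∈ range (m - j), (k + i) ≤ (((m : ℝ) + 1) * n) ^ (m - j) := by
    refine (prod_le_prod (g := fun _ => ((m : ℝ) + 1) * n) (fun i _ => by positivity)
      fun i hi => ?_).trans (by simp)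
    have hi' : (i : ℝ) ≤ m := by
      have := mem_range.1 hi
      exact_mod_cast (by omega : i ≤ m)
    have : (m : ℝ) * 1 ≤ m * n := by gcongr; linarith
    rw [hkdef]
    linarith
  have hpow : √n ^ m * √n ^ (m - 2 * j) = (n : ℝ) ^ (m - j) := by
    rw [← pow_add, show m + (m - 2 * j) = 2 * (m - j) by omega, pow_mul, sq_sqrt (by positivity)]
  have hfac : (1 : ℝ) ≤ 2 ^ (2 * j) * j.factorial * (m - 2 * j).factorial := by
    have : 1 ≤ 2 ^ (2 * j) * j.factorial * (m - 2 * j).factorial := by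
      exact Nat.one_le_iff_ne_zero.2 (by positivity)
    exact_mod_cast this
  have heq : gegenbauerCoeff k m j = (-1) ^ j * (2 ^ m * ∏ i ∈ range (m - j), (k + i)) /
      (2 ^ (2 * j) * j.factorial * (m - 2 * j).factorial) := by
    rw [gegenbauerCoeff, hcast, Gamma_add_nat_eq hk]
    field_simp
  rw [heq, abs_div, abs_mul, abs_pow, abs_neg, abs_one, one_pow, one_mul, hpow,
    abs_of_nonneg (by positivity), abs_of_nonneg (by positivity)]
  refine (div_le_self (by positivity) hfac).trans ?_
  rw [mul_assoc]
  refine mul_le_mul_of_nonneg_left (hprod.trans ?_) (by positivity)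
  rw [mul_pow]
  gcongr
  · linarith [(by positivity : (0 : ℝ) ≤ m)]
  · omega

/-- A bound for the rescaled coefficients of `zonalPoly n m`, uniform in `n`. -/
def zonalBound (m : ℕ) : ℝ :=
  (m / 2 + 1 : ℕ) * (√(m.factorial * (2 * m + 1) * 3 ^ m) * (2 ^ m * ((m : ℝ) + 1) ^ m))

lemma coeffBound_zonalPoly {n : ℕ} (hn : 3 ≤ n) (m : ℕ) :
    CoeffBound √n (zonalBound m) m (zonalPoly n m) := by
  have hA : 0 ≤ Aconst n m := Real.sqrt_nonneg _
  refine ⟨(Polynomial.natDegree_C_mul_le _ _).trans (natDegree_gegenbauerPoly_le _ _), fun d => ?_⟩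
  rw [zonalPoly, gegenbauerPoly, mul_sum, Polynomial.finsetSum_coeff]
  refine (abs_sum_le_sum_abs _ _).trans ?_
  rw [zonalBound, mul_assoc, ← nsmul_eq_mul]
  refine (sum_le_card_nsmul _ _ _ fun j hj => ?_).trans_eq (by rw [card_range])
  have hj' : 2 * j ≤ m := by
    have := mem_range.1 hj
    omega
  rw [← mul_assoc, ← Polynomial.C_mul, Polynomial.coeff_C_mul_X_pow]
  split_ifs with h
  · rw [abs_mul, abs_of_nonneg hA, h]
    calc Aconst n m * |gegenbauerCoeff (((n : ℝ) - 2) / 2) m j|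
        ≤ Aconst n m * (2 ^ m * ((m : ℝ) + 1) ^ m * (√n ^ m * √n ^ (m - 2 * j))) := by
          gcongr
          exact abs_gegenbauerCoeff_le hn hj'
      _ = (Aconst n m * √n ^ m) * (2 ^ m * ((m : ℝ) + 1) ^ m) * √n ^ (m - 2 * j) := by ring
      _ ≤ _ := by
          gcongr
          exact Aconst_mul_pow_le hn m
  · rw [abs_zero]
    positivity

/-- The eigenvalue of the spherical Laplacian on spherical harmonics of degree `m`. -/
def sphereEigenvalue (n m : ℕ) : ℝ := m * (m + ((n : ℝ) - 2))

lemma zonalPoly_ode {n : ℕ} (hn : 3 ≤ n) (m : ℕ) :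
    (1 - Polynomial.X ^ 2) * (zonalPoly n m).derivative.derivative -
      Polynomial.C ((n : ℝ) - 1) * Polynomial.X * (zonalPoly n m).derivative +
      Polynomial.C (sphereEigenvalue n m) * zonalPoly n m = 0 := by
  have hn' : (3 : ℝ) ≤ n := by exact_mod_cast hn
  have h := gegenbauerPoly_ode (show 0 < ((n : ℝ) - 2) / 2 by linarith) m
  rw [show 2 * (((n : ℝ) - 2) / 2) = n - 2 by ring, show (n : ℝ) - 2 + 1 = n - 1 by ring] at h
  simp only [zonalPoly, Polynomial.derivative_C_mul, sphereEigenvalue]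
  linear_combination Polynomial.C (Aconst n m) * h

lemma le_two_mul_sphereEigenvalue {n m : ℕ} (hn : 3 ≤ n) (hm : 1 ≤ m) :
    (n : ℝ) ≤ 2 * sphereEigenvalue n m := by
  have hn' : (3 : ℝ) ≤ n := by exact_mod_cast hn
  have hm' : (1 : ℝ) ≤ m := by exact_mod_cast hm
  rw [sphereEigenvalue]
  nlinarith

/-- The normalised squared derivative of `zonalPoly n m`. -/
def zonalEnergy (n m : ℕ) : Polynomial ℝ :=
  Polynomial.C (1 / sphereEigenvalue n m) *
    ((zonalPoly n m).derivative * (zonalPoly n m).derivative)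

/-- A bound for the rescaled coefficients of `zonalEnergy n m`, uniform in `n`. -/
def zonalEnergyBound (m : ℕ) : ℝ :=
  2 * (((m : ℝ) + m + 1) * (m * zonalBound m) * (m * zonalBound m))

lemma zonalBound_nonneg (m : ℕ) : 0 ≤ zonalBound m := by
  unfold zonalBound
  positivity

lemma zonalEnergyBound_nonneg (m : ℕ) : 0 ≤ zonalEnergyBound m := by
  have := zonalBound_nonneg m
  unfold zonalEnergyBound
  positivity

lemma coeffBound_zonalEnergy {n m : ℕ} (hn : 3 ≤ n) (hm : 1 ≤ m) :
    CoeffBound √n (zonalEnergyBound m) (m + m) (zonalEnergy n m) := by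
  have hs : 0 ≤ √(n : ℝ) := Real.sqrt_nonneg _
  have hd := (coeffBound_zonalPoly hn m).derivative hs
  refine ((hd.mul hs hd).const_mul (1 / sphereEigenvalue n m)).mono hs ?_
  have hμ := le_two_mul_sphereEigenvalue hn hm
  have hn0 : (0 : ℝ) < n := by positivity
  have hμ0 : 0 < sphereEigenvalue n m := by linarith
  rw [abs_of_pos (by positivity), one_div_mul_eq_div, div_le_iff₀ hμ0, zonalEnergyBound]
  have hB := zonalBound_nonneg m
  have : 0 ≤ ((m : ℝ) + m + 1) * (m * zonalBound m) * (m * zonalBound m) := by positivity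
  calc _ = ((m : ℝ) + m + 1) * (m * zonalBound m) * (m * zonalBound m) * (√n * √n) := by
        ring
    _ = ((m : ℝ) + m + 1) * (m * zonalBound m) * (m * zonalBound m) * n := by
        rw [mul_self_sqrt hn0.le]
    _ ≤ ((m : ℝ) + m + 1) * (m * zonalBound m) * (m * zonalBound m) *
          (2 * sphereEigenvalue n m) := by gcongr
    _ = _ := by ring

lemma sphereMean_zonalEnergy_sq_le {m : ℕ} (hm : 1 ≤ m) : ∃ K, 0 ≤ K ∧ ∀ n, 3 ≤ n →
    ∀ i : Fin n, sphereMean (fun x : EuclideanSpace ℝ (Fin n) =>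
      (zonalEnergy n m).eval (x i) ^ 2) ≤ K := by
  refine ⟨?_, ?_, fun n hn i => ?_⟩
  rotate_left 2
  · have hg := coeffBound_zonalEnergy hn hm
    have h := (hg.mul (Real.sqrt_nonneg _) hg).abs_sphereMean_le (by omega) i
    refine (le_abs_self _).trans ?_
    simp only [← sq, Polynomial.eval_pow] at h
    exact h
  · have := zonalEnergyBound_nonneg m
    positivity

lemma sphereMean_sq_mul_zonalEnergy_le {m : ℕ} (hm : 1 ≤ m) : ∃ K, 0 ≤ K ∧ ∀ n, 3 ≤ n →
    ∀ i : Fin n, |sphereMean (fun x : EuclideanSpace ℝ (Fin n) =>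
      x i ^ 2 * (zonalEnergy n m).eval (x i))| ≤ K / n := by
  refine ⟨?_, ?_, fun n hn i => ?_⟩
  rotate_left 2
  · have hg := coeffBound_zonalEnergy hn hm
    have hs : 0 < √(n : ℝ) := Real.sqrt_pos.2 (by positivity)
    have h := ((hg.X_mul hs).X_mul hs).abs_sphereMean_le (by omega) i
    simp only [← mul_assoc, ← sq, Polynomial.eval_mul, Polynomial.eval_pow, Polynomial.eval_X] at h
    rw [div_div, mul_self_sqrt (by positivity), mul_div_assoc'] at h
    exact h
  · have := zonalEnergyBound_nonneg m
    positivity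

lemma abs_covariance_zonalEnergy_le {m : ℕ} (hm : 1 ≤ m) : ∃ K, 0 ≤ K ∧ ∀ n, 3 ≤ n →
    ∀ i j : Fin n, i ≠ j → |sphereMean (fun x : EuclideanSpace ℝ (Fin n) =>
        (zonalEnergy n m).eval (x i) * (zonalEnergy n m).eval (x j)) -
      sphereMean (fun x : EuclideanSpace ℝ (Fin n) => (zonalEnergy n m).eval (x i)) *
      sphereMean (fun x : EuclideanSpace ℝ (Fin n) => (zonalEnergy n m).eval (x j))| ≤ K / n := by
  refine ⟨?_, ?_, fun n hn i j hij => ?_⟩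
  rotate_left 2
  · exact (coeffBound_zonalEnergy hn hm).abs_covariance_le (by omega) hij
  · positivity

lemma sphereMean_zonalEnergy {n m : ℕ} (hn : 3 ≤ n) (hm : 1 ≤ m) (i : Fin n) :
    sphereMean (fun x : EuclideanSpace ℝ (Fin n) => (zonalEnergy n m).eval (x i)) =
      1 + sphereMean (fun x : EuclideanSpace ℝ (Fin n) =>
        x i ^ 2 * (zonalEnergy n m).eval (x i)) := by
  have hode := zonalPoly_ode hn m
  have h := sphereMean_weighted_derivative_sq (by omega) i 0 (sphereEigenvalue n m)
    (y := zonalPoly n m) (by simpa using hode)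
  have hc := fun q => continuous_eval_coord q i
  have hi := continuous_coord i
  have hμ := le_two_mul_sphereEigenvalue hn hm
  have hn0 : (0 : ℝ) < n := by positivity
  have hμ0 : sphereEigenvalue n m ≠ 0 := by linarith
  simp only [zero_add, pow_one, pow_zero, one_mul, sphereMean_zonalPoly_sq hn, mul_one] at h
  rw [← sub_eq_iff_eq_add, ← sphereMean_sub (by omega) (by fun_prop) (by fun_prop)]
  have := congrArg (fun t => 1 / sphereEigenvalue n m * t) h
  simp only [one_div_mul_cancel hμ0, ← sphereMean_const_mul] at this
  rw [← this]
  refine sphereMean_congr fun x _ => ?_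
  simp only [zonalEnergy, Polynomial.eval_mul, Polynomial.eval_C]
  ring

lemma integrable_exp_neg_half_mul_sq : Integrable fun t : ℝ => exp (-(1 / 2) * t ^ 2) :=
  integrable_exp_neg_mul_sq (by norm_num)

lemma hasDerivAt_exp_neg_half_mul_sq (x : ℝ) :
    HasDerivAt (fun t : ℝ => -exp (-(1 / 2) * t ^ 2)) (x * exp (-(1 / 2) * x ^ 2)) x := by
  have h := (((hasDerivAt_pow 2 x).const_mul (-(1 / 2 : ℝ))).exp).neg
  refine h.congr_deriv ?_
  push_cast
  ring

/-- The Mills ratio inequality. -/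
lemma mul_integral_Ioi_exp_neg_half_mul_sq_le (x : ℝ) :
    x * ∫ t in Set.Ioi x, exp (-(1 / 2) * t ^ 2) ≤ exp (-(1 / 2) * x ^ 2) := by
  have hint : Integrable fun t : ℝ => t * exp (-(1 / 2) * t ^ 2) :=
    integrable_mul_exp_neg_mul_sq (by norm_num)
  have hlim : Filter.Tendsto (fun t : ℝ => -exp (-(1 / 2) * t ^ 2)) Filter.atTop (nhds 0) := by
    rw [← neg_zero]
    refine (tendsto_exp_atBot.comp ?_).neg
    refine Filter.Tendsto.const_mul_atTop_of_neg (by norm_num) ?_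
    exact Filter.tendsto_pow_atTop (by norm_num)
  have h := integral_Ioi_of_hasDerivAt_of_tendsto' (a := x)
    (fun t _ => hasDerivAt_exp_neg_half_mul_sq t) hint.integrableOn hlim
  rw [zero_sub, neg_neg] at h
  rw [← h, ← integral_const_mul]
  refine setIntegral_mono_on (integrable_exp_neg_half_mul_sq.const_mul x).integrableOn
    hint.integrableOn measurableSet_Ioi fun t ht => ?_
  exact mul_le_mul_of_nonneg_right (le_of_lt ht) (exp_pos _).le

lemma integral_gaussianReal_eq (φ : ℝ → ℝ) :
    ∫ t, φ t ∂(gaussianReal 0 1) = (√(2 * π))⁻¹ * ∫ t, φ t * exp (-(1 / 2) * t ^ 2) := by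
  rw [integral_gaussianReal_eq_integral_smul one_ne_zero, ← integral_const_mul]
  refine integral_congr_ae (Filter.Eventually.of_forall fun t => ?_)
  simp only [gaussianPDFReal, smul_eq_mul, NNReal.coe_one, mul_one, sub_zero]
  rw [show -t ^ 2 / 2 = -(1 / 2) * t ^ 2 by ring]
  ring

/-- Stein's equation for the standard Gaussian has a solution with bounded derivative. -/
lemma exists_stein_solution {φ : ℝ → ℝ} (hφ : Continuous φ) (hφ0 : ∀ t, 0 ≤ φ t)
    (hφ1 : ∀ t, φ t ≤ 1) :
    ∃ f f' : ℝ → ℝ, (∀ x, HasDerivAt f (f' x) x) ∧ Continuous f' ∧ (∀ x, |f' x| ≤ 2) ∧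
      ∀ x, f' x - x * f x = φ x - ∫ t, φ t ∂(gaussianReal 0 1) := by
  set c := ∫ t, φ t ∂(gaussianReal 0 1) with hc
  have hbound : ∀ t, ‖φ t‖ ≤ 1 := fun t => by
    rw [Real.norm_eq_abs, abs_of_nonneg (hφ0 t)]
    exact hφ1 t
  have hφint : Integrable φ (gaussianReal 0 1) :=
    Integrable.of_bound hφ.aestronglyMeasurable 1 (Filter.Eventually.of_forall hbound)
  have hc0 : 0 ≤ c := integral_nonneg hφ0
  have hc1 : c ≤ 1 := by
    refine (integral_mono hφint (integrable_const 1) hφ1).trans ?_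
    simp
  have hφc : ∀ t, |φ t - c| ≤ 1 := fun t => by
    rw [abs_le]
    constructor <;> linarith [hφ0 t, hφ1 t]
  set w : ℝ → ℝ := fun t => exp (-(1 / 2) * t ^ 2) with hw
  have hwint : Integrable w := integrable_exp_neg_half_mul_sq
  have hwc : Continuous w := by fun_prop
  set v : ℝ → ℝ := fun t => (φ t - c) * w t with hv
  have hvc : Continuous v := (hφ.sub continuous_const).mul hwc
  have hvw : ∀ t, ‖v t‖ ≤ w t := fun t => by
    rw [hv, Real.norm_eq_abs, abs_mul, abs_of_pos (exp_pos _)]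
    exact mul_le_of_le_one_left (exp_pos _).le (hφc t)
  have hvint : Integrable v := hwint.mono' hvc.aestronglyMeasurable
    (Filter.Eventually.of_forall hvw)
  have hφw : Integrable fun t => φ t * w t := hwint.bdd_mul hφ.aestronglyMeasurable
    (Filter.Eventually.of_forall hbound)
  have hv0 : ∫ t, v t = 0 := by
    have h1 : c = (√(2 * π))⁻¹ * ∫ t, φ t * w t := integral_gaussianReal_eq φ
    have h2 : 1 = (√(2 * π))⁻¹ * ∫ t, w t := by
      have h := integral_gaussianReal_eq fun _ => 1
      simp only [integral_const, probReal_univ, smul_eq_mul, one_mul] at h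
      exact h
    have h3 : ∫ t, v t = (∫ t, φ t * w t) - c * ∫ t, w t := by
      rw [← integral_const_mul, ← integral_sub hφw (hwint.const_mul c)]
      refine integral_congr_ae (Filter.Eventually.of_forall fun t => ?_)
      simp only [hv]
      ring
    have hpi : √(2 * π) ≠ 0 := (Real.sqrt_pos.2 (by positivity)).ne'
    rw [eq_inv_mul_iff_mul_eq₀ hpi] at h1 h2
    rw [h3, ← h1, ← h2]
    ring
  set G : ℝ → ℝ := fun x => ∫ t in Set.Iic x, v t with hG
  have hGd : ∀ x, HasDerivAt G (v x) x := by
    intro x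
    have h1 : G = fun y => (∫ t in (0 : ℝ)..y, v t) + G 0 := by
      funext y
      rw [← intervalIntegral.integral_Iic_sub_Iic hvint.integrableOn hvint.integrableOn]
      simp [hG]
    rw [h1]
    exact (intervalIntegral.integral_hasDerivAt_right (hvint.intervalIntegrable)
      (hvc.stronglyMeasurableAtFilter _ _) hvc.continuousAt).add_const _
  have hGle : ∀ x, |x| * |G x| ≤ w x := by
    intro x
    rcases le_total x 0 with hx | hx
    · have h1 : |G x| ≤ ∫ t in Set.Iic x, w t :=
        norm_integral_le_of_norm_le hwint.integrableOn (Filter.Eventually.of_forall hvw)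
      have h2 : ∫ t in Set.Iic x, w t = ∫ t in Set.Ioi (-x), w t := by
        rw [← integral_comp_neg_Iic]
        simp [hw]
      have h3 := mul_integral_Ioi_exp_neg_half_mul_sq_le (-x)
      rw [neg_sq] at h3
      rw [abs_of_nonpos hx]
      rw [h2] at h1
      exact (mul_le_mul_of_nonneg_left h1 (by linarith)).trans h3
    · have h0 : G x = -∫ t in Set.Ioi x, v t := by
        have := intervalIntegral.integral_Iic_add_Ioi (b := x) (μ := volume)
          hvint.integrableOn hvint.integrableOn
        rw [hv0] at this
        simp only [hG]
        linarith
      have h1 : |G x| ≤ ∫ t in Set.Ioi x, w t := by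
        rw [h0, abs_neg]
        exact norm_integral_le_of_norm_le hwint.integrableOn (Filter.Eventually.of_forall hvw)
      rw [abs_of_nonneg hx]
      exact (mul_le_mul_of_nonneg_left h1 hx).trans (mul_integral_Ioi_exp_neg_half_mul_sq_le x)
  have hfd : ∀ x, HasDerivAt (fun x => exp (1 / 2 * x ^ 2) * G x)
      (x * (exp (1 / 2 * x ^ 2) * G x) + (φ x - c)) x := by
    intro x
    have he : exp (1 / 2 * x ^ 2) * w x = 1 := by
      rw [hw, ← exp_add]
      simp
    have h := (((hasDerivAt_pow 2 x).const_mul (1 / 2 : ℝ)).exp).mul (hGd x)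
    refine h.congr_deriv ?_
    simp only [hv]
    push_cast
    linear_combination (φ x - c) * he
  have hGc : Continuous G := continuous_iff_continuousAt.2 fun x => (hGd x).continuousAt
  refine ⟨fun x => exp (1 / 2 * x ^ 2) * G x, fun x => x * (exp (1 / 2 * x ^ 2) * G x) + (φ x - c),
    hfd, by fun_prop, fun x => ?_, fun x => by ring⟩
  have he : exp (1 / 2 * x ^ 2) * w x = 1 := by
    rw [hw, ← exp_add]
    simp
  have h1 : |x * (exp (1 / 2 * x ^ 2) * G x)| ≤ 1 := by
    refine le_of_le_of_eq ?_ he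
    rw [abs_mul, abs_mul, abs_of_pos (exp_pos _)]
    calc |x| * (exp (1 / 2 * x ^ 2) * |G x|) = exp (1 / 2 * x ^ 2) * (|x| * |G x|) := by ring
      _ ≤ _ := mul_le_mul_of_nonneg_left (hGle x) (exp_pos _).le
  calc _ ≤ _ := abs_add_le _ _
    _ ≤ 1 + 1 := add_le_add h1 (hφc x)
    _ = 2 := by norm_num

/-- Total variation is controlled by continuous test functions with values in `[0, 1]`. -/
lemma dTV_le_of_forall_continuous {μ ν : Measure ℝ} [IsProbabilityMeasure μ]
    [IsProbabilityMeasure ν] {b : ℝ}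
    (h : ∀ φ : ℝ → ℝ, Continuous φ → (∀ t, 0 ≤ φ t) → (∀ t, φ t ≤ 1) →
      |(∫ t, φ t ∂μ) - ∫ t, φ t ∂ν| ≤ b) : dTV μ ν ≤ b := by
  have : Nonempty {s : Set ℝ // MeasurableSet s} := ⟨⟨∅, MeasurableSet.empty⟩⟩
  refine ciSup_le fun s => le_of_forall_pos_le_add fun ε hε => ?_
  obtain ⟨s, hs⟩ := s
  set F : ℝ → ℝ := s.indicator fun _ => 1 with hF
  have hFint : ∀ (ρ : Measure ℝ) [IsFiniteMeasure ρ], Integrable F ρ := fun ρ _ =>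
    (integrable_const 1).indicator hs
  obtain ⟨g, -, hgε, hgc, hgint⟩ :=
    (hFint (μ + ν)).exists_hasCompactSupport_integral_sub_le hε
  set φ : ℝ → ℝ := fun t => max 0 (min 1 (g t)) with hφ
  have hφc : Continuous φ := by fun_prop
  have hφ0 : ∀ t, 0 ≤ φ t := fun t => le_max_left _ _
  have hφ1 : ∀ t, φ t ≤ 1 := fun t => max_le zero_le_one (min_le_left _ _)
  have hφint : ∀ (ρ : Measure ℝ) [IsFiniteMeasure ρ], Integrable φ ρ := fun ρ _ =>
    Integrable.of_bound hφc.aestronglyMeasurable 1 (Filter.Eventually.of_forall fun t => by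
      rw [Real.norm_eq_abs, abs_of_nonneg (hφ0 t)]
      exact hφ1 t)
  have hle : ∀ t, |F t - φ t| ≤ ‖F t - g t‖ := by
    intro t
    rw [Real.norm_eq_abs]
    by_cases ht : t ∈ s
    · simp only [hF, hφ, Set.indicator_of_mem ht]
      rcases le_total (g t) 1 with h1 | h1 <;> rcases le_total (g t) 0 with h2 | h2 <;>
        simp only [min_eq_left, min_eq_right, max_eq_left, max_eq_right, h1, h2, zero_le_one,
          sub_self, abs_zero, abs_nonneg, le_refl]
      rw [abs_of_nonneg (by norm_num), abs_of_nonneg (by linarith)]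
      linarith
    · simp only [hF, hφ, Set.indicator_of_notMem ht]
      rcases le_total (g t) 1 with h1 | h1 <;> rcases le_total (g t) 0 with h2 | h2 <;>
        simp only [min_eq_left, min_eq_right, max_eq_left, max_eq_right, h1, h2, zero_le_one,
          sub_self, abs_zero, abs_nonneg, le_refl]
      all_goals
        rw [abs_of_nonpos (by norm_num), abs_of_nonpos (by linarith)]
        linarith
  have hI : ∀ (ρ : Measure ℝ) [IsFiniteMeasure ρ],
      |(ρ s).toReal - ∫ t, φ t ∂ρ| ≤ ∫ t, |F t - φ t| ∂ρ := by
    intro ρ _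
    have : (ρ s).toReal = ∫ t, F t ∂ρ := by
      rw [hF, integral_indicator_const _ hs]
      simp [Measure.real]
    rw [this, ← integral_sub (hFint ρ) (hφint ρ)]
    exact abs_integral_le_integral_abs
  have hsum : (∫ t, |F t - φ t| ∂μ) + ∫ t, |F t - φ t| ∂ν ≤ ε := by
    have habs : ∀ (ρ : Measure ℝ) [IsFiniteMeasure ρ], Integrable (fun t => |F t - φ t|) ρ :=
      fun ρ _ => ((hFint ρ).sub (hφint ρ)).abs
    rw [← integral_add_measure (habs μ) (habs ν)]
    exact (integral_mono (habs _) ((hFint _).sub hgint).norm hle).trans hgε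
  have h1 := abs_le.1 (hI μ)
  have h2 := abs_le.1 (hI ν)
  have h3 := abs_le.1 (h φ hφc hφ0 hφ1)
  rw [abs_le]
  constructor <;> linarith [h1.1, h1.2, h2.1, h2.2, h3.1, h3.2]

/-- Stein's integration by parts for a linear combination of zonal functions. -/
lemma sphereMean_stein_identity {n : ℕ} (hn : 1 ≤ n) {q : Polynomial ℝ} {κ : ℝ}
    (hq : (1 - Polynomial.X ^ 2) * q.derivative.derivative -
      Polynomial.C ((n : ℝ) - 1) * Polynomial.X * q.derivative + Polynomial.C κ * q = 0)
    (a : Fin n → ℝ) {f f' : ℝ → ℝ} (hf : ∀ t, HasDerivAt f (f' t) t) (hf' : Continuous f') :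
    sphereMean (fun x : EuclideanSpace ℝ (Fin n) =>
        f' (∑ i, a i * q.eval (x i)) * ((∑ i, a i ^ 2 * q.derivative.eval (x i) ^ 2) -
          (∑ i, a i * (x i * q.derivative.eval (x i))) ^ 2)) =
      κ * sphereMean (fun x : EuclideanSpace ℝ (Fin n) =>
        (∑ i, a i * q.eval (x i)) * f (∑ i, a i * q.eval (x i))) := by
  have hfc : Continuous f := continuous_iff_continuousAt.2 fun t => (hf t).continuousAt
  set p : EuclideanSpace ℝ (Fin n) → ℝ := fun x => ∑ i, a i * q.eval (x i) with hp
  set p' : EuclideanSpace ℝ (Fin n) → EuclideanSpace ℝ (Fin n) →L[ℝ] ℝ := fun x =>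
    ∑ j, a j • (q.derivative.eval (x j) • EuclideanSpace.proj j) with hp'
  have hpd : ∀ x, HasFDerivAt p (p' x) x := fun x =>
    HasFDerivAt.fun_sum fun j _ =>
      (hasFDerivAt_comp_coord (fun t => q.hasDerivAt t) j x).const_mul (a j)
  have hev : ∀ (r : Polynomial ℝ) (i : Fin n),
      Continuous fun x : EuclideanSpace ℝ (Fin n) => r.eval (x i) := continuous_eval_coord
  have hco : ∀ i : Fin n, Continuous fun x : EuclideanSpace ℝ (Fin n) => x i := continuous_coord
  have hpc : Continuous p := by fun_prop
  have hp'c : Continuous p' := by fun_prop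
  have hfp : ∀ x, HasFDerivAt (fun x => f (p x)) (f' (p x) • p' x) x := fun x =>
    (hf (p x)).comp_hasFDerivAt x (hpd x)
  have hui : ∀ i x, HasFDerivAt (fun x => f (p x) * q.derivative.eval (x i))
      (f (p x) • (q.derivative.derivative.eval (x i) • EuclideanSpace.proj (𝕜 := ℝ) i) +
        q.derivative.eval (x i) • (f' (p x) • p' x)) x := fun i x =>
    (hfp x).mul (hasFDerivAt_comp_coord (fun t => q.derivative.hasDerivAt t) i x)
  have hibp : ∀ i, _ := fun i => sphereMean_integration_by_parts hn (hui i) (by fun_prop) i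
  have hD : ∀ x : EuclideanSpace ℝ (Fin n),
      p' x x = ∑ j, a j * (x j * q.derivative.eval (x j)) := by
    intro x
    simp only [hp', _root_.sum_apply, _root_.smul_apply,
      PiLp.proj_apply, smul_eq_mul]
    exact sum_congr rfl fun j _ => by ring
  have hs : ∀ (i : Fin n) x, p' x (EuclideanSpace.single i 1) = a i * q.derivative.eval (x i) := by
    intro i x
    simp only [hp', _root_.sum_apply, _root_.smul_apply,
      PiLp.proj_apply, smul_eq_mul]
    rw [sum_eq_single i]
    · simp
    · intro j _ hj
      simp [hj]
    · simp
  simp only [_root_.add_apply, _root_.smul_apply, hD, hs,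
    PiLp.proj_apply, smul_eq_mul, PiLp.single_apply, if_true, mul_one] at hibp
  have hsum := sum_congr (s₁ := (univ : Finset (Fin n))) rfl fun i _ =>
    congrArg (fun t => a i * t) (hibp i)
  simp only [← sphereMean_const_mul] at hsum
  rw [← sphereMean_sum hn _ (fun i _ => by fun_prop),
    ← sphereMean_sum hn _ (fun i _ => by fun_prop)] at hsum
  rw [← sphereMean_const_mul]
  refine sphereMean_eq_of_sub_eq hn hsum (by fun_prop) (by fun_prop) (by fun_prop) (by fun_prop)
    fun x => ?_
  have hode : ∀ i, (1 - x i ^ 2) * q.derivative.derivative.eval (x i) -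
      ((n : ℝ) - 1) * x i * q.derivative.eval (x i) + κ * q.eval (x i) = 0 := fun i => by
    simpa using congrArg (Polynomial.eval (x i)) hq
  have hkp : κ * p x = ∑ i, a i * (((n : ℝ) - 1) * x i * q.derivative.eval (x i) -
      (1 - x i ^ 2) * q.derivative.derivative.eval (x i)) := by
    rw [hp, mul_sum]
    exact sum_congr rfl fun i _ => by linear_combination a i * hode i
  rw [← mul_assoc, hkp]
  set D := ∑ j, a j * (x j * q.derivative.eval (x j)) with hDdef
  rw [mul_sub, sq D]
  nth_rewrite 2 [hDdef]
  rw [sum_mul, mul_sum, mul_sum, sum_mul, ← sum_sub_distrib, ← sum_sub_distrib, ← sum_sub_distrib]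
  refine sum_congr rfl fun i _ => ?_
  ring

lemma dTV_map_le {n : ℕ} (hn : 1 ≤ n) {q : Polynomial ℝ} {κ : ℝ} (hκ : 0 < κ)
    (hq : (1 - Polynomial.X ^ 2) * q.derivative.derivative -
      Polynomial.C ((n : ℝ) - 1) * Polynomial.X * q.derivative + Polynomial.C κ * q = 0)
    (a : Fin n → ℝ) :
    dTV (Measure.map (fun x : Metric.sphere (0 : EuclideanSpace ℝ (Fin n)) 1 =>
        ∑ i, a i * q.eval ((x : EuclideanSpace ℝ (Fin n)) i)) (sphereUniform (Fin n)))
      (gaussianReal 0 1) ≤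
    2 * sphereMean (fun x : EuclideanSpace ℝ (Fin n) =>
      |κ⁻¹ * ((∑ i, a i ^ 2 * q.derivative.eval (x i) ^ 2) -
          (∑ i, a i * (x i * q.derivative.eval (x i))) ^ 2) - 1|) := by
  have := isProbabilityMeasure_sphereUniform hn
  have hev : ∀ (r : Polynomial ℝ) (i : Fin n),
      Continuous fun x : EuclideanSpace ℝ (Fin n) => r.eval (x i) := continuous_eval_coord
  have hco : ∀ i : Fin n, Continuous fun x : EuclideanSpace ℝ (Fin n) => x i := continuous_coord
  set p : EuclideanSpace ℝ (Fin n) → ℝ := fun x => ∑ i, a i * q.eval (x i) with hp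
  have hpc : Continuous p := by fun_prop
  have hpc' : Continuous fun x : Metric.sphere (0 : EuclideanSpace ℝ (Fin n)) 1 => p x :=
    hpc.comp continuous_subtype_val
  have : IsProbabilityMeasure (Measure.map
      (fun x : Metric.sphere (0 : EuclideanSpace ℝ (Fin n)) 1 => p x) (sphereUniform (Fin n))) :=
    Measure.isProbabilityMeasure_map hpc'.aemeasurable
  refine dTV_le_of_forall_continuous fun φ hφ hφ0 hφ1 => ?_
  obtain ⟨f, f', hf, hf'c, hf'2, hstein⟩ := exists_stein_solution hφ hφ0 hφ1
  have hfc : Continuous f := continuous_iff_continuousAt.2 fun t => (hf t).continuousAt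
  set c := ∫ t, φ t ∂(gaussianReal 0 1)
  set T : EuclideanSpace ℝ (Fin n) → ℝ := fun x => κ⁻¹ *
    ((∑ i, a i ^ 2 * q.derivative.eval (x i) ^ 2) -
      (∑ i, a i * (x i * q.derivative.eval (x i))) ^ 2) with hT
  have hTc : Continuous T := by fun_prop
  have h1 : ∫ t, φ t ∂(Measure.map
      (fun x : Metric.sphere (0 : EuclideanSpace ℝ (Fin n)) 1 => p x) (sphereUniform (Fin n))) =
      sphereMean fun x => φ (p x) :=
    integral_map hpc'.aemeasurable hφ.aestronglyMeasurable
  have hid : sphereMean (fun x => f' (p x) * T x) = sphereMean fun x => p x * f (p x) := by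
    have h := congrArg (fun t => κ⁻¹ * t) (sphereMean_stein_identity hn hq a hf hf'c)
    simp only [inv_mul_cancel_left₀ hκ.ne', ← sphereMean_const_mul] at h
    rw [← h]
    refine sphereMean_congr fun x _ => ?_
    simp only [hT, hp]
    ring
  have h2 : (sphereMean fun x => φ (p x)) - c = sphereMean fun x => f' (p x) * (1 - T x) := by
    rw [← sphereMean_const hn c, ← sphereMean_sub hn (by fun_prop) (by fun_prop)]
    have h3 : sphereMean (fun x => f' (p x) * (1 - T x)) =
        sphereMean (fun x => f' (p x)) - sphereMean fun x => f' (p x) * T x := by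
      rw [← sphereMean_sub hn (by fun_prop) (by fun_prop)]
      exact sphereMean_congr fun x _ => by ring
    rw [h3, hid, ← sphereMean_sub hn (by fun_prop) (by fun_prop)]
    exact sphereMean_congr fun x _ => (hstein (p x)).symm
  rw [h1, h2, ← sphereMean_const_mul]
  have h4 : |sphereMean fun x => f' (p x) * (1 - T x)| ≤
      sphereMean fun x => |f' (p x) * (1 - T x)| := abs_integral_le_integral_abs
  refine h4.trans (sphereMean_mono hn (by fun_prop) (by fun_prop)
    fun x _ => ?_)
  rw [abs_mul, abs_sub_comm]
  exact mul_le_mul_of_nonneg_right (hf'2 _) (abs_nonneg _)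

lemma norm_coe_sphere_eq_one {n : ℕ} (a : Metric.sphere (0 : EuclideanSpace ℝ (Fin n)) 1) :
    ‖(a : EuclideanSpace ℝ (Fin n))‖ = 1 := by
  simp

lemma eval_zonalEnergy (n m : ℕ) (t : ℝ) :
    (zonalEnergy n m).eval t =
      (sphereEigenvalue n m)⁻¹ * (zonalPoly n m).derivative.eval t ^ 2 := by
  simp only [zonalEnergy, Polynomial.eval_mul, Polynomial.eval_C, one_div, sq]

lemma sphereMean_energy_sub_one_mul_le {m : ℕ} (hm : 1 ≤ m) : ∃ V, 0 ≤ V ∧ ∀ n, 3 ≤ n →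
    ∀ i j : Fin n, sphereMean (fun x : EuclideanSpace ℝ (Fin n) =>
      ((zonalEnergy n m).eval (x i) - 1) * ((zonalEnergy n m).eval (x j) - 1)) ≤
      V / n + if i = j then V else 0 := by
  obtain ⟨K₁, hK₁, h₁⟩ := sphereMean_zonalEnergy_sq_le hm
  obtain ⟨K₂, hK₂, h₂⟩ := sphereMean_sq_mul_zonalEnergy_le hm
  obtain ⟨K₃, hK₃, h₃⟩ := abs_covariance_zonalEnergy_le hm
  refine ⟨K₃ + K₂ ^ 2 + 2 * K₁ + 2, by positivity, fun n hn i j => ?_⟩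
  have hn1 : 1 ≤ n := by omega
  have hn' : (1 : ℝ) ≤ n := by exact_mod_cast hn1
  have hev : ∀ (r : Polynomial ℝ) (i : Fin n),
      Continuous fun x : EuclideanSpace ℝ (Fin n) => r.eval (x i) := continuous_eval_coord
  split_ifs with hij
  · subst hij
    have h : sphereMean (fun x : EuclideanSpace ℝ (Fin n) =>
        ((zonalEnergy n m).eval (x i) - 1) * ((zonalEnergy n m).eval (x i) - 1)) ≤
        sphereMean fun x => 2 * (zonalEnergy n m).eval (x i) ^ 2 + 2 :=
      sphereMean_mono hn1 (by fun_prop) (by fun_prop) fun x _ => by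
        nlinarith [sq_nonneg ((zonalEnergy n m).eval (x i) + 1)]
    rw [sphereMean_add hn1 (by fun_prop) (by fun_prop), sphereMean_const_mul,
      sphereMean_const hn1] at h
    have h1 := h₁ n hn i
    have h4 : 0 ≤ (K₃ + K₂ ^ 2 + 2 * K₁ + 2) / n := by positivity
    have h5 : 0 ≤ K₃ + K₂ ^ 2 := by positivity
    linarith
  · have hexp : sphereMean (fun x : EuclideanSpace ℝ (Fin n) =>
        ((zonalEnergy n m).eval (x i) - 1) * ((zonalEnergy n m).eval (x j) - 1)) =
        sphereMean (fun x : EuclideanSpace ℝ (Fin n) =>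
          (zonalEnergy n m).eval (x i) * (zonalEnergy n m).eval (x j)) -
        sphereMean (fun x : EuclideanSpace ℝ (Fin n) => (zonalEnergy n m).eval (x i)) -
        sphereMean (fun x : EuclideanSpace ℝ (Fin n) => (zonalEnergy n m).eval (x j)) +
        sphereMean fun _ : EuclideanSpace ℝ (Fin n) => (1 : ℝ) := by
      rw [← sphereMean_sub hn1 (by fun_prop) (by fun_prop),
        ← sphereMean_sub hn1 (by fun_prop) (by fun_prop),
        ← sphereMean_add hn1 (by fun_prop) (by fun_prop)]
      exact sphereMean_congr fun x _ => by ring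
    have hc := (abs_le.1 (h₃ n hn i j hij)).2
    have hi := h₂ n hn i
    have hj := h₂ n hn j
    rw [sphereMean_zonalEnergy hn hm, sphereMean_zonalEnergy hn hm] at hexp hc
    rw [hexp, sphereMean_const hn1, add_zero]
    generalize sphereMean (fun x : EuclideanSpace ℝ (Fin n) =>
      x i ^ 2 * (zonalEnergy n m).eval (x i)) = u at *
    generalize sphereMean (fun x : EuclideanSpace ℝ (Fin n) =>
      x j ^ 2 * (zonalEnergy n m).eval (x j)) = v at *
    have huv : u * v ≤ K₂ ^ 2 / n := by
      calc u * v ≤ |u * v| := le_abs_self _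
        _ = |u| * |v| := abs_mul _ _
        _ ≤ K₂ / n * (K₂ / n) := by gcongr
        _ = K₂ ^ 2 / n / n := by ring
        _ ≤ K₂ ^ 2 / n := div_le_self (by positivity) hn'
    have h4 : 0 ≤ (2 * K₁ + 2) / n := by positivity
    have h5 : (K₃ + K₂ ^ 2 + 2 * K₁ + 2) / n = K₃ / n + K₂ ^ 2 / n + (2 * K₁ + 2) / n := by ring
    rw [h5]
    linarith

lemma sphereMean_sum_sq_mul_energy_sub_one_sq_le {m : ℕ} (hm : 1 ≤ m) : ∃ V, 0 ≤ V ∧ ∀ n, 3 ≤ n →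
    ∀ a : EuclideanSpace ℝ (Fin n), ‖a‖ = 1 → sphereMean (fun x : EuclideanSpace ℝ (Fin n) =>
      ((∑ i, a i ^ 2 * (zonalEnergy n m).eval (x i)) - 1) ^ 2) ≤ V / n + V * ∑ i, a i ^ 4 := by
  obtain ⟨V, hV, h⟩ := sphereMean_energy_sub_one_mul_le hm
  refine ⟨V, hV, fun n hn a ha => ?_⟩
  have hn1 : 1 ≤ n := by omega
  have hev : ∀ (r : Polynomial ℝ) (i : Fin n),
      Continuous fun x : EuclideanSpace ℝ (Fin n) => r.eval (x i) := continuous_eval_coord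
  have hsq := sum_sq_eq_one ha
  have hexp : ∀ x : EuclideanSpace ℝ (Fin n),
      ((∑ i, a i ^ 2 * (zonalEnergy n m).eval (x i)) - 1) ^ 2 =
      ∑ i, ∑ j, a i ^ 2 * a j ^ 2 *
        (((zonalEnergy n m).eval (x i) - 1) * ((zonalEnergy n m).eval (x j) - 1)) := by
    intro x
    nth_rewrite 1 [← hsq]
    rw [← sum_sub_distrib, sq, sum_mul_sum]
    exact sum_congr rfl fun i _ => sum_congr rfl fun j _ => by ring
  simp only [hexp]
  rw [sphereMean_sum hn1 _ fun i _ => by fun_prop]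
  have hone : ∑ i, ∑ j, a i ^ 2 * a j ^ 2 = 1 := by
    rw [← sum_mul_sum, hsq, one_mul]
  calc ∑ i, sphereMean (fun x : EuclideanSpace ℝ (Fin n) => ∑ j, a i ^ 2 * a j ^ 2 *
        (((zonalEnergy n m).eval (x i) - 1) * ((zonalEnergy n m).eval (x j) - 1)))
      = ∑ i, ∑ j, a i ^ 2 * a j ^ 2 * sphereMean (fun x : EuclideanSpace ℝ (Fin n) =>
        ((zonalEnergy n m).eval (x i) - 1) * ((zonalEnergy n m).eval (x j) - 1)) := by
        refine sum_congr rfl fun i _ => ?_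
        rw [sphereMean_sum hn1 _ fun j _ => by fun_prop]
        exact sum_congr rfl fun j _ => sphereMean_const_mul _ _
    _ ≤ ∑ i, ∑ j, a i ^ 2 * a j ^ 2 * (V / n + if i = j then V else 0) := by
        gcongr with i _ j _
        exact h n hn i j
    _ = V / n * ∑ i, ∑ j, a i ^ 2 * a j ^ 2 + V * ∑ i, a i ^ 4 := by
        simp only [mul_add, sum_add_distrib, mul_ite, mul_zero, sum_ite_eq, mem_univ, if_true]
        congr 1
        · simp only [mul_sum]
          exact sum_congr rfl fun i _ => sum_congr rfl fun j _ => by ring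
        · rw [mul_sum]
          exact sum_congr rfl fun i _ => by ring
    _ = _ := by rw [hone, mul_one]

lemma abs_le_half_mul_sq_add_inv {s : ℝ} (hs : 0 < s) (t : ℝ) :
    2 * |t| ≤ s * t ^ 2 + 1 / s := by
  have h : s * t ^ 2 + 1 / s - 2 * |t| = (s * |t| - 1) ^ 2 / s := by
    rw [← sq_abs t]
    field_simp
    ring
  have : 0 ≤ (s * |t| - 1) ^ 2 / s := by positivity
  linarith

lemma dTV_map_pli_le {m : ℕ} (hm : 1 ≤ m) : ∃ V, 0 ≤ V ∧ ∀ n, 3 ≤ n →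
    ∀ a : EuclideanSpace ℝ (Fin n), ‖a‖ = 1 →
    dTV (Measure.map (fun x : Metric.sphere (0 : EuclideanSpace ℝ (Fin n)) 1 =>
        ∑ i, a i * pli n m i x) (sphereUniform (Fin n))) (gaussianReal 0 1) ≤
      √n * (V / n + V * ∑ i, a i ^ 4) + 1 / √n +
        2 * ∑ i, ∑ j, sphereMean (fun x : EuclideanSpace ℝ (Fin n) => (sphereEigenvalue n m)⁻¹ *
          (x i * (zonalPoly n m).derivative.eval (x i) *
            (x j * (zonalPoly n m).derivative.eval (x j)))) * (a i * a j) := by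
  obtain ⟨V, hV, h⟩ := sphereMean_sum_sq_mul_energy_sub_one_sq_le hm
  refine ⟨V, hV, fun n hn a ha => ?_⟩
  have hn1 : 1 ≤ n := by omega
  have hev : ∀ (r : Polynomial ℝ) (i : Fin n),
      Continuous fun x : EuclideanSpace ℝ (Fin n) => r.eval (x i) := continuous_eval_coord
  have hco : ∀ i : Fin n, Continuous fun x : EuclideanSpace ℝ (Fin n) => x i := continuous_coord
  have hn0 : (0 : ℝ) < n := by positivity
  have hs : 0 < √(n : ℝ) := Real.sqrt_pos.2 hn0
  have hκ : 0 < sphereEigenvalue n m := by linarith [le_two_mul_sphereEigenvalue hn hm]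
  simp only [← eval_zonalPoly]
  refine (dTV_map_le hn1 hκ (zonalPoly_ode hn m) fun i => a i).trans ?_
  rw [← sphereMean_const_mul]
  set R : EuclideanSpace ℝ (Fin n) → ℝ := fun x => (sphereEigenvalue n m)⁻¹ *
    (∑ i, a i * (x i * (zonalPoly n m).derivative.eval (x i))) ^ 2 with hR
  set S : EuclideanSpace ℝ (Fin n) → ℝ := fun x =>
    ∑ i, a i ^ 2 * (zonalEnergy n m).eval (x i) with hS
  have hRc : Continuous R := by fun_prop
  have hSc : Continuous S := by fun_prop
  have hbound : sphereMean (fun x : EuclideanSpace ℝ (Fin n) =>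
      2 * |(sphereEigenvalue n m)⁻¹ *
        ((∑ i, a i ^ 2 * (zonalPoly n m).derivative.eval (x i) ^ 2) -
          (∑ i, a i * (x i * (zonalPoly n m).derivative.eval (x i))) ^ 2) - 1|) ≤
      sphereMean fun x => √n * (S x - 1) ^ 2 + 1 / √n + 2 * R x := by
    refine sphereMean_mono hn1 (by fun_prop) (by fun_prop) fun x _ => ?_
    have hR0 : 0 ≤ R x := by
      simp only [hR]
      positivity
    have h1 : (sphereEigenvalue n m)⁻¹ *
        ((∑ i, a i ^ 2 * (zonalPoly n m).derivative.eval (x i) ^ 2) -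
          (∑ i, a i * (x i * (zonalPoly n m).derivative.eval (x i))) ^ 2) - 1 =
        (S x - 1) - R x := by
      have h2 : (sphereEigenvalue n m)⁻¹ *
          (∑ i, a i ^ 2 * (zonalPoly n m).derivative.eval (x i) ^ 2) = S x := by
        simp only [hS, eval_zonalEnergy, mul_sum]
        exact sum_congr rfl fun i _ => by ring
      rw [mul_sub, h2]
      ring
    rw [h1]
    have h3 := abs_sub (S x - 1) (R x)
    rw [abs_of_nonneg hR0] at h3
    linarith [abs_le_half_mul_sq_add_inv hs (S x - 1)]
  refine hbound.trans ?_
  rw [sphereMean_add hn1 (by fun_prop) (by fun_prop),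
    sphereMean_add hn1 (by fun_prop) (by fun_prop), sphereMean_const hn1, sphereMean_const_mul,
    sphereMean_const_mul]
  have hRexp : sphereMean R = ∑ i, ∑ j, sphereMean (fun x : EuclideanSpace ℝ (Fin n) =>
      (sphereEigenvalue n m)⁻¹ * (x i * (zonalPoly n m).derivative.eval (x i) *
        (x j * (zonalPoly n m).derivative.eval (x j)))) * (a i * a j) := by
    have hx : ∀ x, R x = ∑ i, ∑ j, (a i * a j) * ((sphereEigenvalue n m)⁻¹ *
        (x i * (zonalPoly n m).derivative.eval (x i) *
          (x j * (zonalPoly n m).derivative.eval (x j)))) := by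
      intro x
      simp only [hR]
      rw [sq, sum_mul_sum, mul_sum]
      refine sum_congr rfl fun i _ => ?_
      rw [mul_sum]
      exact sum_congr rfl fun j _ => by ring
    rw [sphereMean_congr fun x _ => hx x, sphereMean_sum hn1 _ fun i _ => by fun_prop]
    refine sum_congr rfl fun i _ => ?_
    rw [sphereMean_sum hn1 _ fun j _ => by fun_prop]
    exact sum_congr rfl fun j _ => by rw [sphereMean_const_mul, mul_comm]
  rw [hRexp]
  gcongr
  exact h n hn a ha

lemma sphereMean_coord_sq {n : ℕ} (hn : 1 ≤ n) (i : Fin n) :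
    sphereMean (fun x : EuclideanSpace ℝ (Fin n) => x i ^ 2) = 1 / n := by
  have h := sphereMean_coord_pow hn i 0
  simp only [pow_zero, sphereMean_const hn, Nat.cast_zero, add_zero, zero_add, mul_one] at h
  have : (n : ℝ) ≠ 0 := by positivity
  rw [eq_div_iff this, mul_comm, h]

lemma sphereMean_sum_coord_pow_four_le {n : ℕ} (hn : 1 ≤ n) :
    sphereMean (fun x : EuclideanSpace ℝ (Fin n) => ∑ i, x i ^ 4) ≤ 3 / n := by
  have hco : ∀ i : Fin n, Continuous fun x : EuclideanSpace ℝ (Fin n) => x i := continuous_coord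
  have hn0 : (0 : ℝ) < n := by positivity
  rw [sphereMean_sum hn _ fun i _ => by fun_prop]
  have h4 : ∀ i : Fin n, sphereMean (fun x : EuclideanSpace ℝ (Fin n) => x i ^ 4) ≤
      3 / (n * n) := by
    intro i
    have h := sphereMean_coord_pow hn i 2
    rw [sphereMean_coord_sq hn] at h
    have h0 : 0 ≤ sphereMean (fun x : EuclideanSpace ℝ (Fin n) => x i ^ 4) :=
      integral_nonneg fun x => by positivity
    norm_num at h
    rw [le_div_iff₀ (by positivity)]
    have h1 : n * ((n + 2) * sphereMean (fun x : EuclideanSpace ℝ (Fin n) => x i ^ 4)) = 3 := by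
      rw [h]
      field_simp
    nlinarith
  refine (sum_le_sum fun i _ => h4 i).trans_eq ?_
  simp
  field_simp

lemma sphereMean_quadratic_form {n : ℕ} (hn : 2 ≤ n) (M : Fin n → Fin n → ℝ) :
    sphereMean (fun a : EuclideanSpace ℝ (Fin n) => ∑ i, ∑ j, M i j * (a i * a j)) =
      ∑ i, M i i / n := by
  have hco : ∀ i : Fin n, Continuous fun x : EuclideanSpace ℝ (Fin n) => x i := continuous_coord
  have hn1 : 1 ≤ n := by omega
  rw [sphereMean_sum hn1 _ fun i _ => by fun_prop]
  refine sum_congr rfl fun i _ => ?_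
  rw [sphereMean_sum hn1 _ fun j _ => by fun_prop, sum_eq_single i]
  · simp only [sphereMean_const_mul, ← sq, sphereMean_coord_sq hn1]
    ring
  · intro j _ hj
    have h := sphereMean_coord_mul_pow hn hj.symm 1
    simp only [pow_one] at h
    rw [sphereMean_const_mul, h, mul_zero]
  · simp

lemma dTV_nonneg (μ ν : Measure ℝ) : 0 ≤ dTV μ ν :=
  Real.iSup_nonneg fun _ => abs_nonneg _

theorem stmt3 (ℓ : ℕ) (hodd : Odd ℓ) (hl : 1 ≤ ℓ) :
    ∃ c' > (0 : ℝ), ∀ n : ℕ, 3 ≤ n →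
      (∫ a : Metric.sphere (0 : EuclideanSpace ℝ (Fin n)) 1,
          dTV (MeasureTheory.Measure.map
                (fun x : Metric.sphere (0 : EuclideanSpace ℝ (Fin n)) 1 =>
                  ∑ i, (a : EuclideanSpace ℝ (Fin n)) i * pli n ℓ i x)
                (sphereUniform (Fin n)))
              (gaussianReal 0 1) ∂(sphereUniform (Fin n)))
        ≤ c' / Real.sqrt n := by
  obtain ⟨V, hV, h⟩ := dTV_map_pli_le hl
  obtain ⟨K, hK, hR⟩ := sphereMean_sq_mul_zonalEnergy_le hl
  refine ⟨4 * V + 1 + 2 * K, by positivity, fun n hn => ?_⟩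
  have hn1 : 1 ≤ n := by omega
  have hn' : (1 : ℝ) ≤ n := by exact_mod_cast hn1
  have hs : 0 < √(n : ℝ) := Real.sqrt_pos.2 (by positivity)
  have hprob := isProbabilityMeasure_sphereUniform hn1
  have hco : ∀ i : Fin n, Continuous fun x : EuclideanSpace ℝ (Fin n) => x i := continuous_coord
  set M : Fin n → Fin n → ℝ := fun i j => sphereMean (fun x : EuclideanSpace ℝ (Fin n) =>
    (sphereEigenvalue n ℓ)⁻¹ * (x i * (zonalPoly n ℓ).derivative.eval (x i) *
      (x j * (zonalPoly n ℓ).derivative.eval (x j)))) with hM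
  set B : EuclideanSpace ℝ (Fin n) → ℝ := fun a =>
    √n * (V / n + V * ∑ i, a i ^ 4) + 1 / √n + 2 * ∑ i, ∑ j, M i j * (a i * a j) with hB
  have hBc : Continuous B := by fun_prop
  have hle : _ ≤ sphereMean B := integral_mono_of_nonneg
    (Filter.Eventually.of_forall fun a => dTV_nonneg _ _) hBc.integrable_sphereUniform
    (Filter.Eventually.of_forall fun a => h n hn a (norm_coe_sphere_eq_one a))
  refine hle.trans ?_
  have hMii : ∀ i, M i i ≤ K / n := by
    intro i
    refine le_trans (le_of_eq ?_) ((le_abs_self _).trans (hR n hn i))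
    refine sphereMean_congr fun x _ => ?_
    rw [eval_zonalEnergy]
    ring
  have hMsum : ∑ i, M i i / n ≤ K / n := by
    calc ∑ i, M i i / n ≤ ∑ _i : Fin n, K / n / n := by
          gcongr with i _
          exact hMii i
      _ = K / n := by
          simp
          field_simp
  have hKn : K / n ≤ K / √n := by
    gcongr
    exact Real.sqrt_le_iff.2 ⟨by positivity, by nlinarith⟩
  have h4 := sphereMean_sum_coord_pow_four_le hn1
  have hBmean : sphereMean B = √n * (V / n + V * sphereMean (fun a : EuclideanSpace ℝ (Fin n) =>
      ∑ i, a i ^ 4)) + 1 / √n + 2 * ∑ i, M i i / n := by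
    rw [← sphereMean_quadratic_form (by omega), ← sphereMean_const_mul, ← sphereMean_const_mul,
      ← sphereMean_const hn1 (V / n), ← sphereMean_add hn1 (by fun_prop) (by fun_prop),
      ← sphereMean_const_mul, ← sphereMean_const hn1 (1 / √n),
      ← sphereMean_add hn1 (by fun_prop) (by fun_prop),
      ← sphereMean_add hn1 (by fun_prop) (by fun_prop)]
  have hsn : √(n : ℝ) * (1 / n) = 1 / √n := by
    field_simp
    rw [sq_sqrt (by positivity)]
  calc sphereMean B ≤ √n * (V / n + V * (3 / n)) + 1 / √n + 2 * (K / √n) := by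
        rw [hBmean]
        gcongr
        exact hMsum.trans hKn
    _ = 4 * V * (√n * (1 / n)) + 1 / √n + 2 * (K / √n) := by ring
    _ = (4 * V + 1 + 2 * K) / √n := by
        rw [hsn]
        ring

end
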